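/- arXiv:1602.07944 — 2 statements merged into one kernel-verified Lean document; each statement's English description precedes it below -/
import Mathlib

section
/- For every integer u with u ≡ 2 (mod 12) and u ≥ 14, there exists a 3-SCGDP* of type 2^{(u,5)} with (u(u−1)−14)/3 base blocks. -/
/-- A 3-SCGDP* of type 2^{(u,t)} with b base blocks: a 3-SCGDP of type 2^u
(a 2-cyclic 3-GDP on `I_u × Z_2` with groups `{i} × Z_2`: blocks of size 3,
at most one point per group, each pair from distinct groups in at most one
block, block set invariant under the shift of the second coordinate; since
each block orbit has length exactly 2, having b base blocks means having 2·b
blocks) such that additionally, for all a, b ∈ I_t and x ∈ Z_2, no block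
contains both (a,x) and (b,x+1). -/
def IsSCGDPstar (u t b : ℕ) (ℬ : Finset (Finset (Fin u × ZMod 2))) : Prop :=
  ℬ.card = 2 * b ∧
  (∀ B ∈ ℬ, B.card = 3) ∧
  (∀ B ∈ ℬ, ∀ p ∈ B, ∀ q ∈ B, p ≠ q → p.1 ≠ q.1) ∧
  (∀ p q : Fin u × ZMod 2, p.1 ≠ q.1 →
    (ℬ.filter (fun B => p ∈ B ∧ q ∈ B)).card ≤ 1) ∧
  (∀ B ∈ ℬ, B.image (fun p => (p.1, p.2 + 1)) ∈ ℬ) ∧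
  (∀ a b : Fin u, (a : ℕ) < t → (b : ℕ) < t → ∀ x : ZMod 2, ∀ B ∈ ℬ,
    ¬((a, x) ∈ B ∧ (b, x + 1) ∈ B))

/-- A family of triples on `V × ZMod 2` with exactly `N` members, closed under the shift of the
second coordinate, in which two distinct points lie in at most one common block and are related
by `R` whenever they do. -/
def HasPacking {V : Type*} [DecidableEq V] (R : V × ZMod 2 → V × ZMod 2 → Prop) (N : ℕ) : Prop :=
  ∃ ℬ : Finset (Finset (V × ZMod 2)), ℬ.card = N ∧
    (∀ B ∈ ℬ, B.card = 3) ∧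
    (∀ B ∈ ℬ, ∀ p ∈ B, ∀ q ∈ B, p ≠ q → R p q) ∧
    (∀ B ∈ ℬ, ∀ C ∈ ℬ, ∀ p ∈ B, ∀ q ∈ B, p ∈ C → q ∈ C → p ≠ q → B = C) ∧
    (∀ B ∈ ℬ, B.image (fun p => (p.1, p.2 + 1)) ∈ ℬ)

namespace HasPacking

variable {V W : Type*} [DecidableEq V] [DecidableEq W]

/-- A packing given by an indexed family of triples. -/
theorem of_family {R : V × ZMod 2 → V × ZMod 2 → Prop} {T : Type*} [Fintype T]
    (pt : T → Fin 3 → V × ZMod 2) (hirr : ∀ p, ¬ R p p)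
    (hR : ∀ t i j, i ≠ j → R (pt t i) (pt t j))
    (hpt : ∀ t t' i j i' j', i ≠ j → i' ≠ j' →
      pt t i = pt t' i' → pt t j = pt t' j' → t = t')
    (hshift : ∀ t, ∃ t', ∀ i, pt t' i = ((pt t i).1, (pt t i).2 + 1)) :
    HasPacking R (Fintype.card T) := by
  have hinj : ∀ t, Function.Injective (pt t) := by
    intro t i j h
    by_contra hij
    exact hirr _ (h ▸ hR t i j hij)
  have huniq : ∀ t t', ∀ p q, p ≠ q → p ∈ Finset.univ.image (pt t) → q ∈ Finset.univ.image (pt t) →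
      p ∈ Finset.univ.image (pt t') → q ∈ Finset.univ.image (pt t') → t = t' := by
    intro t t' p q hpq hp hq hp' hq'
    simp only [Finset.mem_image, Finset.mem_univ, true_and] at hp hq hp' hq'
    obtain ⟨i, rfl⟩ := hp
    obtain ⟨j, rfl⟩ := hq
    obtain ⟨i', hi⟩ := hp'
    obtain ⟨j', hj⟩ := hq'
    refine hpt t t' i j i' j' (fun h => hpq (by rw [h])) (fun h => hpq ?_) hi.symm hj.symm
    rw [← hi, ← hj, h]
  refine ⟨Finset.univ.image fun t => Finset.univ.image (pt t), ?_, ?_, ?_, ?_, ?_⟩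
  · rw [Finset.card_image_of_injective, Finset.card_univ]
    intro t t' h
    have h' : Finset.univ.image (pt t) = Finset.univ.image (pt t') := h
    refine huniq t t' (pt t 0) (pt t 1) (fun h01 => absurd (hinj t h01) (by decide)) ?_ ?_ ?_ ?_
    · simp
    · simp
    · simp [← h']
    · simp [← h']
  · intro B hB
    obtain ⟨t, -, rfl⟩ := Finset.mem_image.1 hB
    rw [Finset.card_image_of_injective _ (hinj t), Finset.card_univ, Fintype.card_fin]
  · intro B hB p hp q hq hpq
    obtain ⟨t, -, rfl⟩ := Finset.mem_image.1 hB
    obtain ⟨i, -, rfl⟩ := Finset.mem_image.1 hp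
    obtain ⟨j, -, rfl⟩ := Finset.mem_image.1 hq
    exact hR t i j fun h => hpq (by rw [h])
  · intro B hB C hC p hp q hq hp' hq' hpq
    obtain ⟨t, -, rfl⟩ := Finset.mem_image.1 hB
    obtain ⟨t', -, rfl⟩ := Finset.mem_image.1 hC
    rw [huniq t t' p q hpq hp hq hp' hq']
  · intro B hB
    obtain ⟨t, -, rfl⟩ := Finset.mem_image.1 hB
    obtain ⟨t', ht'⟩ := hshift t
    refine Finset.mem_image.2 ⟨t', Finset.mem_univ _, ?_⟩
    rw [Finset.image_image]
    exact Finset.image_congr fun i _ => ht' i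

theorem mono {R R' : V × ZMod 2 → V × ZMod 2 → Prop} {N : ℕ} (h : HasPacking R N)
    (hRR' : ∀ p q, R p q → R' p q) : HasPacking R' N := by
  obtain ⟨ℬ, h₁, h₂, h₃, h₄, h₅⟩ := h
  exact ⟨ℬ, h₁, h₂, fun B hB p hp q hq hpq => hRR' _ _ (h₃ B hB p hp q hq hpq), h₄, h₅⟩

theorem map {R : V × ZMod 2 → V × ZMod 2 → Prop} {R' : W × ZMod 2 → W × ZMod 2 → Prop} {N : ℕ}
    (h : HasPacking R N) {f : V → W} (hf : Function.Injective f)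
    (hR : ∀ p q, R p q → R' (f p.1, p.2) (f q.1, q.2)) : HasPacking R' N := by
  obtain ⟨ℬ, h₁, h₂, h₃, h₄, h₅⟩ := h
  let g : V × ZMod 2 → W × ZMod 2 := fun p => (f p.1, p.2)
  have hg : Function.Injective g := by
    intro p q hpq
    obtain ⟨h1, h2⟩ := Prod.mk.inj hpq
    exact Prod.ext (hf h1) h2
  refine ⟨ℬ.image (Finset.image g), ?_, ?_, ?_, ?_, ?_⟩
  · rw [Finset.card_image_of_injective _ (Finset.image_injective hg), h₁]
  · intro B hB
    obtain ⟨B', hB', rfl⟩ := Finset.mem_image.1 hB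
    rw [Finset.card_image_of_injective _ hg, h₂ B' hB']
  · intro B hB p hp q hq hpq
    obtain ⟨B', hB', rfl⟩ := Finset.mem_image.1 hB
    obtain ⟨p', hp₀, rfl⟩ := Finset.mem_image.1 hp
    obtain ⟨q', hq₀, rfl⟩ := Finset.mem_image.1 hq
    exact hR p' q' (h₃ B' hB' p' hp₀ q' hq₀ fun h => hpq (by rw [h]))
  · intro B hB C hC p hp q hq hp' hq' hpq
    obtain ⟨B', hB', rfl⟩ := Finset.mem_image.1 hB
    obtain ⟨C', hC', rfl⟩ := Finset.mem_image.1 hC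
    obtain ⟨p', hp₀, rfl⟩ := Finset.mem_image.1 hp
    obtain ⟨q', hq₀, rfl⟩ := Finset.mem_image.1 hq
    rw [hg.mem_finset_image] at hp' hq'
    rw [h₄ B' hB' C' hC' p' hp₀ q' hq₀ hp' hq' fun h => hpq (by rw [h])]
  · intro B hB
    obtain ⟨B', hB', rfl⟩ := Finset.mem_image.1 hB
    refine Finset.mem_image.2 ⟨_, h₅ B' hB', ?_⟩
    rw [Finset.image_image, Finset.image_image]
    rfl

theorem union {R R' : V × ZMod 2 → V × ZMod 2 → Prop} {N N' : ℕ} (h : HasPacking R N)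
    (h' : HasPacking R' N') (hdisj : ∀ p q, R p q → ¬ R' p q) :
    HasPacking (fun p q => R p q ∨ R' p q) (N + N') := by
  obtain ⟨ℬ, h₁, h₂, h₃, h₄, h₅⟩ := h
  obtain ⟨ℬ', h₁', h₂', h₃', h₄', h₅'⟩ := h'
  have hcross : ∀ B ∈ ℬ, ∀ C ∈ ℬ', ∀ p ∈ B, ∀ q ∈ B, p ∈ C → q ∈ C → p = q := by
    intro B hB C hC p hp q hq hp' hq'
    by_contra hpq
    exact hdisj p q (h₃ B hB p hp q hq hpq) (h₃' C hC p hp' q hq' hpq)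
  refine ⟨ℬ ∪ ℬ', ?_, ?_, ?_, ?_, ?_⟩
  · rw [Finset.card_union_of_disjoint, h₁, h₁']
    rw [Finset.disjoint_left]
    intro B hB hB'
    obtain ⟨p, hp, q, hq, hpq⟩ := Finset.one_lt_card.1 (by rw [h₂ B hB]; norm_num : 1 < B.card)
    exact hpq (hcross B hB B hB' p hp q hq hp hq)
  · intro B hB
    exact (Finset.mem_union.1 hB).elim (h₂ B) (h₂' B)
  · intro B hB p hp q hq hpq
    exact (Finset.mem_union.1 hB).imp (h₃ B · p hp q hq hpq) (h₃' B · p hp q hq hpq)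
  · intro B hB C hC p hp q hq hp' hq' hpq
    rcases Finset.mem_union.1 hB with hB | hB <;> rcases Finset.mem_union.1 hC with hC | hC
    · exact h₄ B hB C hC p hp q hq hp' hq' hpq
    · exact absurd (hcross B hB C hC p hp q hq hp' hq') hpq
    · exact absurd (hcross C hC B hB p hp' q hq' hp hq) hpq
    · exact h₄' B hB C hC p hp q hq hp' hq' hpq
  · intro B hB
    exact Finset.mem_union.2 ((Finset.mem_union.1 hB).imp (h₅ B) (h₅' B))

theorem biUnion {ι : Type*} [DecidableEq ι] {R : ι → V × ZMod 2 → V × ZMod 2 → Prop} {N : ℕ}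
    (s : Finset ι) (h : ∀ i ∈ s, HasPacking (R i) N)
    (hdisj : ∀ i ∈ s, ∀ j ∈ s, i ≠ j → ∀ p q, R i p q → ¬ R j p q) :
    HasPacking (fun p q => ∃ i ∈ s, R i p q) (s.card * N) := by
  induction s using Finset.induction_on with
  | empty => exact ⟨∅, by simp, by simp, by simp, by simp, by simp⟩
  | insert a s ha ih =>
    have hs := ih (fun i hi => h i (Finset.mem_insert_of_mem hi)) fun i hi j hj =>
      hdisj i (Finset.mem_insert_of_mem hi) j (Finset.mem_insert_of_mem hj)
    have hu := (h a (Finset.mem_insert_self a s)).union hs (by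
      rintro p q hpq ⟨i, hi, hi'⟩
      exact hdisj a (Finset.mem_insert_self a s) i (Finset.mem_insert_of_mem hi)
        (fun h => ha (h ▸ hi)) p q hpq hi')
    rw [Finset.card_insert_of_notMem ha, add_mul, one_mul, add_comm]
    refine hu.mono ?_
    rintro p q (hpq | ⟨i, hi, hpq⟩)
    · exact ⟨a, Finset.mem_insert_self a s, hpq⟩
    · exact ⟨i, Finset.mem_insert_of_mem hi, hpq⟩

end HasPacking

section Tables

/-- The three edges, each with the difference of its second coordinates, of the base block
`{(a, 0), (b, s), (c, t)}` recorded as `(a, b, c, s, t)`. -/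
def rowEdges {u : ℕ} :
    Fin u × Fin u × Fin u × ZMod 2 × ZMod 2 → List (Fin u × Fin u × ZMod 2)
  | (a, b, c, s, t) => [(a, b, s), (a, c, t), (b, c, t - s)]

/-- The translate by `x` of the base block recorded by a row. -/
def rowPoint {u : ℕ} (x : ZMod 2) :
    Fin u × Fin u × Fin u × ZMod 2 × ZMod 2 → Fin 3 → Fin u × ZMod 2
  | (a, b, c, s, t) => ![(a, x), (b, x + s), (c, x + t)]

/-- The edge joining two points, listed from its smaller first coordinate. -/
def joiningEdge {u : ℕ} (p q : Fin u × ZMod 2) : Fin u × Fin u × ZMod 2 :=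
  if p.1 < q.1 then (p.1, q.1, q.2 - p.2) else (q.1, p.1, p.2 - q.2)

theorem joiningEdge_mem_rowEdges {u : ℕ} (r : Fin u × Fin u × Fin u × ZMod 2 × ZMod 2)
    (hr : ∀ e ∈ rowEdges r, e.1 < e.2.1) (x : ZMod 2) {i j : Fin 3} (hij : i ≠ j) :
    joiningEdge (rowPoint x r i) (rowPoint x r j) ∈ rowEdges r := by
  obtain ⟨a, b, c, s, t⟩ := r
  simp only [rowEdges, List.mem_cons, List.not_mem_nil, or_false, forall_eq_or_imp,
    forall_eq] at hr
  obtain ⟨hab, hac, hbc⟩ := hr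
  fin_cases i <;> fin_cases j <;>
    simp [rowPoint, joiningEdge, rowEdges, hab, hac, hbc, hab.not_gt, hac.not_gt, hbc.not_gt]
      at hij ⊢

theorem exists_rowPoint_eq {u : ℕ} (r : Fin u × Fin u × Fin u × ZMod 2 × ZMod 2)
    (hr : ∀ e ∈ rowEdges r, e.1 < e.2.1) (x : ZMod 2) {i j : Fin 3} (hij : i ≠ j) :
    ∃ e ∈ rowEdges r, ∃ y : ZMod 2,
      (rowPoint x r i = (e.1, y) ∧ rowPoint x r j = (e.2.1, y + e.2.2)) ∨
      (rowPoint x r j = (e.1, y) ∧ rowPoint x r i = (e.2.1, y + e.2.2)) := by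
  refine ⟨_, joiningEdge_mem_rowEdges r hr x hij, ?_⟩
  unfold joiningEdge
  split_ifs
  · exact ⟨(rowPoint x r i).2, Or.inl ⟨rfl, by simp⟩⟩
  · exact ⟨(rowPoint x r j).2, Or.inr ⟨rfl, by simp⟩⟩

theorem rowPoint_shift_injective {u : ℕ} (r : Fin u × Fin u × Fin u × ZMod 2 × ZMod 2)
    (hr : ∀ e ∈ rowEdges r, e.1 < e.2.1) {x y : ZMod 2} {i j : Fin 3}
    (h : rowPoint x r i = rowPoint y r j) : x = y := by
  obtain ⟨a, b, c, s, t⟩ := r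
  simp only [rowEdges, List.mem_cons, List.not_mem_nil, or_false, forall_eq_or_imp,
    forall_eq] at hr
  obtain ⟨hab, hac, hbc⟩ := hr
  fin_cases i <;> fin_cases j <;>
    simp [rowPoint, hab.ne, hac.ne, hbc.ne, hab.ne', hac.ne', hbc.ne'] at h ⊢ <;> exact h

/-- Base blocks with pairwise distinct edges yield a packing. -/
theorem HasPacking.of_rows {u : ℕ} {R : Fin u × ZMod 2 → Fin u × ZMod 2 → Prop}
    (l : List (Fin u × Fin u × Fin u × ZMod 2 × ZMod 2)) (hirr : ∀ p, ¬ R p p)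
    (hsymm : ∀ p q, R p q → R q p)
    (hlt : ∀ r ∈ l, ∀ e ∈ rowEdges r, e.1 < e.2.1)
    (hR : ∀ r ∈ l, ∀ e ∈ rowEdges r, ∀ x, R (e.1, x) (e.2.1, x + e.2.2))
    (hnodup : ((l.flatMap rowEdges).map fun e => (e.1.val * u + e.2.1.val) * 2 + e.2.2.val).Nodup) :
    HasPacking R (2 * l.length) := by
  have hdisj := (List.nodup_flatMap.1 (List.Nodup.of_map _ hnodup)).2
  rw [List.pairwise_iff_getElem] at hdisj
  have hcard : Fintype.card (ZMod 2 × Fin l.length) = 2 * l.length := by simp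
  rw [← hcard]
  refine HasPacking.of_family (fun t : ZMod 2 × Fin l.length => rowPoint t.1 l[t.2]) hirr ?_ ?_ ?_
  · rintro ⟨x, k⟩ i j hij
    have hk : l[k] ∈ l := List.getElem_mem _
    obtain ⟨e, he, y, ⟨h₁, h₂⟩ | ⟨h₁, h₂⟩⟩ := exists_rowPoint_eq l[k] (hlt _ hk) x hij
    · simpa only [h₁, h₂] using hR _ hk e he y
    · simpa only [h₁, h₂] using hsymm _ _ (hR _ hk e he y)
  · rintro ⟨x, k⟩ ⟨x', k'⟩ i j i' j' hij hij' hi hj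
    dsimp only at hi hj
    have hk : l[k] ∈ l := List.getElem_mem _
    have hk' : l[k'] ∈ l := List.getElem_mem _
    have h := joiningEdge_mem_rowEdges l[k] (hlt _ hk) x hij
    have h' := joiningEdge_mem_rowEdges l[k'] (hlt _ hk') x' hij'
    rw [hi, hj] at h
    have hkk : k = k' := by
      rcases lt_trichotomy k k' with hlt | heq | hgt
      · exact absurd h' (hdisj k k' k.2 k'.2 hlt h)
      · exact heq
      · exact absurd h (hdisj k' k k'.2 k.2 hgt h')
    subst hkk
    rw [rowPoint_shift_injective l[k] (hlt _ hk) hi]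
  · rintro ⟨x, k⟩
    refine ⟨(x + 1, k), fun i => ?_⟩
    generalize hr : l[(x, k).2] = r
    obtain ⟨a, b, c, s, t⟩ := r
    fin_cases i <;> simp [rowPoint, add_right_comm]

/-- Whether the numbers in a list are pairwise distinct and avoid the positions of the ones in the
binary expansion of `m`. -/
def distinctFrom : ℕ → List ℕ → Bool
  | _, [] => true
  | m, c :: l => Nat.beq (m / 2 ^ c % 2) 0 && distinctFrom (m ||| 2 ^ c) l

theorem nodup_of_distinctFrom {m : ℕ} {l : List ℕ} (h : distinctFrom m l = true) :
    l.Nodup ∧ ∀ c ∈ l, m.testBit c = false := by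
  induction l generalizing m with
  | nil => simp
  | cons c l ih =>
    simp only [distinctFrom, Bool.and_eq_true, Nat.beq_eq] at h
    obtain ⟨hnd, hl⟩ := ih h.2
    simp only [Nat.testBit_or, Nat.testBit_two_pow, Bool.or_eq_false_iff,
      decide_eq_false_iff_not] at hl
    refine ⟨List.nodup_cons.2 ⟨fun hc => (hl c hc).2 rfl, hnd⟩, ?_⟩
    intro d hd
    rcases List.mem_cons.1 hd with rfl | hd
    · simp [Nat.testBit_eq_decide_div_mod_eq, h.1]
    · exact (hl d hd).1

/-- Whether a row of numbers is increasing and bounded as a base block should be, with all three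
edges accepted by `ok`. -/
def rowValid (u : ℕ) (ok : ℕ → ℕ → ℕ → Bool) : ℕ × ℕ × ℕ × ℕ × ℕ → Bool
  | (a, b, c, s, t) => Nat.blt a b && Nat.blt b c && Nat.blt c u && Nat.blt s 2 && Nat.blt t 2 &&
      ok a b s && ok a c t && ok b c ((s + t) % 2)

/-- The edges of a row, encoded as numbers. -/
def rowCodes (u : ℕ) : ℕ × ℕ × ℕ × ℕ × ℕ → List ℕ
  | (a, b, c, s, t) =>
    [(a * u + b) * 2 + s, (a * u + c) * 2 + t, (b * u + c) * 2 + (s + t) % 2]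

/-- The base block recorded by a row of numbers. -/
def rowCast (u : ℕ) [NeZero u] :
    ℕ × ℕ × ℕ × ℕ × ℕ → Fin u × Fin u × Fin u × ZMod 2 × ZMod 2
  | (a, b, c, s, t) => (Fin.ofNat u a, Fin.ofNat u b, Fin.ofNat u c, s, t)

theorem rowEdges_rowCast {u : ℕ} [NeZero u] {ok : ℕ → ℕ → ℕ → Bool} {r : ℕ × ℕ × ℕ × ℕ × ℕ}
    (h : rowValid u ok r = true) :
    (∀ e ∈ rowEdges (rowCast u r), e.1 < e.2.1 ∧ ok e.1.val e.2.1.val e.2.2.val = true) ∧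
    (rowEdges (rowCast u r)).map (fun e => (e.1.val * u + e.2.1.val) * 2 + e.2.2.val) =
      rowCodes u r := by
  obtain ⟨a, b, c, s, t⟩ := r
  simp only [rowValid, Bool.and_eq_true, Nat.blt_eq] at h
  obtain ⟨⟨⟨⟨⟨⟨⟨hab, hbc⟩, hc⟩, hs⟩, ht⟩, h₁⟩, h₂⟩, h₃⟩ := h
  have ha' := Nat.mod_eq_of_lt (hab.trans (hbc.trans hc))
  have hb' := Nat.mod_eq_of_lt (hbc.trans hc)
  have hc' := Nat.mod_eq_of_lt hc
  have hst : ((t : ZMod 2) - s).val = (s + t) % 2 ∧ (s : ZMod 2).val = s ∧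
      (t : ZMod 2).val = t := by
    interval_cases s <;> interval_cases t <;> decide
  simp only [rowCast, rowEdges, rowCodes, List.mem_cons, List.not_mem_nil, or_false,
    forall_eq_or_imp, forall_eq, List.map_cons, List.map_nil, Fin.lt_def, Fin.val_ofNat, ha', hb',
    hc', hst, h₁, h₂, h₃, and_true]
  exact ⟨hab, hab.trans hbc, hbc⟩

theorem HasPacking.of_natRows {u : ℕ} [NeZero u] {R : Fin u × ZMod 2 → Fin u × ZMod 2 → Prop}
    (ok : ℕ → ℕ → ℕ → Bool) (l : List (ℕ × ℕ × ℕ × ℕ × ℕ)) (hirr : ∀ p, ¬ R p p)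
    (hsymm : ∀ p q, R p q → R q p)
    (hR : ∀ (a b : Fin u) (s x : ZMod 2), a < b → ok a.val b.val s.val = true →
      R (a, x) (b, x + s))
    (hvalid : l.all (rowValid u ok) = true)
    (hdist : distinctFrom 0 (l.flatMap (rowCodes u)) = true) :
    HasPacking R (2 * l.length) := by
  rw [List.all_eq_true] at hvalid
  have hmem : ∀ r ∈ l.map (rowCast u), ∀ e ∈ rowEdges r,
      e.1 < e.2.1 ∧ ok e.1.val e.2.1.val e.2.2.val = true := by
    intro r hr
    obtain ⟨r', hr', rfl⟩ := List.mem_map.1 hr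
    exact (rowEdges_rowCast (hvalid r' hr')).1
  rw [← List.length_map (rowCast u)]
  refine HasPacking.of_rows _ hirr hsymm (fun r hr e he => (hmem r hr e he).1)
    (fun r hr e he x => hR _ _ _ x (hmem r hr e he).1 (hmem r hr e he).2) ?_
  have hcodes : ((l.map (rowCast u)).flatMap rowEdges).map
      (fun e => (e.1.val * u + e.2.1.val) * 2 + e.2.2.val) = l.flatMap (rowCodes u) := by
    rw [List.flatMap_map, List.map_flatMap]
    exact List.flatMap_congr fun r hr => (rowEdges_rowCast (hvalid r hr)).2
  rw [hcodes]
  exact (nodup_of_distinctFrom hdist).1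

end Tables

section SmallOrders

/-- Two points in different groups, not both among the groups `0` and `1`. -/
def holeRel (u : ℕ) (p q : Fin u × ZMod 2) : Prop :=
  p.1 ≠ q.1 ∧ ¬ (p.1.val < 2 ∧ q.1.val < 2)

/-- Two points in different groups, with equal second coordinates if both lie in the first five
groups. -/
def starRel (u : ℕ) (p q : Fin u × ZMod 2) : Prop :=
  p.1 ≠ q.1 ∧ (p.1.val < 5 → q.1.val < 5 → p.2 = q.2)

theorem holeRel_irrefl (u : ℕ) (p : Fin u × ZMod 2) : ¬ holeRel u p p := fun h => h.1 rfl

theorem starRel_irrefl (u : ℕ) (p : Fin u × ZMod 2) : ¬ starRel u p p := fun h => h.1 rfl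

theorem holeRel_symm (u : ℕ) (p q : Fin u × ZMod 2) (h : holeRel u p q) : holeRel u q p :=
  ⟨h.1.symm, fun h' => h.2 h'.symm⟩

theorem starRel_symm (u : ℕ) (p q : Fin u × ZMod 2) (h : starRel u p q) : starRel u q p :=
  ⟨h.1.symm, fun hq hp => (h.2 hp hq).symm⟩

theorem hasPacking_holeRel_of_rows {u : ℕ} [NeZero u] (l : List (ℕ × ℕ × ℕ × ℕ × ℕ))
    (hvalid : l.all (rowValid u fun _ b _ => Nat.ble 2 b) = true)
    (hdist : distinctFrom 0 (l.flatMap (rowCodes u)) = true) :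
    HasPacking (holeRel u) (2 * l.length) := by
  refine .of_natRows _ l (holeRel_irrefl u) (holeRel_symm u) ?_ hvalid hdist
  intro a b s x hab hb
  have := Nat.le_of_ble_eq_true hb
  exact ⟨hab.ne, by dsimp only; omega⟩

theorem hasPacking_starRel_of_rows {u : ℕ} [NeZero u] (l : List (ℕ × ℕ × ℕ × ℕ × ℕ))
    (hvalid : l.all (rowValid u fun _ b s => Nat.ble 5 b || Nat.beq s 0) = true)
    (hdist : distinctFrom 0 (l.flatMap (rowCodes u)) = true) :
    HasPacking (starRel u) (2 * l.length) := by
  refine .of_natRows _ l (starRel_irrefl u) (starRel_symm u) ?_ hvalid hdist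
  intro a b s x hab hb
  rw [Bool.or_eq_true, Nat.ble_eq, Nat.beq_eq] at hb
  refine ⟨hab.ne, fun _ hb' => ?_⟩
  rcases hb with hb | hb
  · exact absurd hb' hb.not_gt
  · rw [(ZMod.val_eq_zero s).1 hb, add_zero]

/-- Base blocks of a packing of order 14 with a hole of size two. -/
def holeRows14 : List (ℕ × ℕ × ℕ × ℕ × ℕ) := [
  (0, 2, 3, 0, 0), (0, 2, 9, 1, 1), (0, 3, 10, 1, 0), (0, 4, 6, 0, 0), (0, 4, 8, 1, 1),
  (0, 5, 6, 1, 1), (0, 5, 12, 0, 1), (0, 7, 11, 0, 0), (0, 7, 13, 1, 0), (0, 8, 9, 0, 0),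
  (0, 10, 13, 1, 1), (0, 11, 12, 1, 0), (1, 2, 4, 1, 0), (1, 2, 13, 0, 0), (1, 3, 8, 1, 0),
  (1, 3, 12, 0, 1), (1, 4, 10, 1, 0), (1, 5, 7, 1, 1), (1, 5, 10, 0, 1), (1, 6, 9, 1, 0),
  (1, 6, 13, 0, 1), (1, 7, 11, 0, 1), (1, 8, 11, 1, 0), (1, 9, 12, 1, 0), (2, 3, 13, 1, 1),
  (2, 4, 6, 0, 1), (2, 5, 8, 1, 1), (2, 5, 12, 0, 0), (2, 6, 11, 0, 1), (2, 7, 9, 1, 1),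
  (2, 7, 10, 0, 1), (2, 8, 12, 0, 1), (2, 10, 11, 0, 0), (3, 4, 9, 1, 0), (3, 4, 11, 0, 1),
  (3, 5, 6, 1, 0), (3, 5, 9, 0, 1), (3, 6, 7, 1, 1), (3, 7, 12, 0, 0), (3, 8, 11, 0, 0),
  (3, 10, 13, 0, 1), (4, 5, 10, 0, 0), (4, 5, 11, 1, 0), (4, 7, 12, 0, 1), (4, 7, 13, 1, 1),
  (4, 8, 9, 1, 0), (4, 12, 13, 0, 0), (5, 7, 9, 1, 0), (5, 8, 13, 1, 1), (5, 11, 13, 0, 0),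
  (6, 7, 8, 1, 0), (6, 8, 10, 1, 0), (6, 9, 13, 0, 0), (6, 10, 12, 1, 1), (6, 11, 12, 0, 0),
  (7, 8, 10, 0, 0), (8, 12, 13, 0, 1), (9, 10, 11, 0, 1), (9, 10, 12, 1, 0), (9, 11, 13, 0, 1)]

/-- Base blocks of a packing of order 14 with the restriction on the first five groups. -/
def starRows14 : List (ℕ × ℕ × ℕ × ℕ × ℕ) := [
  (0, 1, 6, 0, 0), (0, 2, 11, 0, 1), (0, 3, 12, 0, 1), (0, 4, 10, 0, 1), (0, 5, 11, 1, 0),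
  (0, 5, 13, 0, 1), (0, 6, 8, 1, 0), (0, 7, 9, 1, 0), (0, 7, 12, 0, 0), (0, 8, 9, 1, 1),
  (0, 10, 13, 0, 0), (1, 2, 4, 0, 0), (1, 3, 13, 0, 0), (1, 5, 7, 0, 0), (1, 5, 13, 1, 1),
  (1, 6, 9, 1, 0), (1, 7, 9, 1, 1), (1, 8, 10, 1, 0), (1, 8, 12, 0, 1), (1, 10, 11, 1, 1),
  (1, 11, 12, 0, 0), (2, 3, 5, 0, 1), (2, 5, 6, 0, 1), (2, 6, 11, 0, 0), (2, 7, 8, 0, 1),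
  (2, 7, 13, 1, 0), (2, 8, 10, 0, 0), (2, 9, 10, 0, 1), (2, 9, 12, 1, 0), (2, 12, 13, 1, 1),
  (3, 4, 6, 0, 0), (3, 5, 9, 0, 1), (3, 6, 12, 1, 0), (3, 7, 10, 0, 1), (3, 7, 11, 1, 0),
  (3, 8, 11, 1, 1), (3, 8, 13, 0, 1), (3, 9, 10, 0, 0), (4, 5, 8, 0, 0), (4, 5, 9, 1, 1),
  (4, 6, 7, 1, 0), (4, 7, 11, 1, 1), (4, 8, 13, 1, 1), (4, 9, 12, 0, 0), (4, 10, 12, 0, 1),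
  (4, 11, 13, 0, 0), (5, 7, 10, 1, 1), (5, 10, 12, 0, 0), (5, 11, 12, 0, 1), (6, 8, 12, 0, 0),
  (6, 9, 13, 0, 1), (6, 10, 11, 0, 1), (6, 10, 13, 1, 0), (7, 12, 13, 1, 0), (8, 9, 11, 1, 1),
  (9, 11, 13, 1, 0)]

/-- Base blocks of a packing of order 26 with a hole of size two. -/
def holeRows26 : List (ℕ × ℕ × ℕ × ℕ × ℕ) := [
  (0, 2, 14, 0, 1), (0, 2, 25, 1, 0), (0, 3, 6, 1, 0), (0, 3, 23, 0, 0), (0, 4, 21, 1, 1),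
  (0, 4, 23, 0, 1), (0, 5, 13, 0, 1), (0, 5, 15, 1, 0), (0, 6, 8, 1, 0), (0, 7, 12, 0, 0),
  (0, 7, 19, 1, 1), (0, 8, 12, 1, 1), (0, 9, 14, 1, 0), (0, 9, 21, 0, 0), (0, 10, 11, 0, 0),
  (0, 10, 16, 1, 1), (0, 11, 13, 1, 0), (0, 15, 22, 1, 0), (0, 16, 20, 0, 1), (0, 17, 18, 0, 1),
  (0, 17, 20, 1, 0), (0, 18, 24, 0, 0), (0, 19, 24, 0, 1), (0, 22, 25, 1, 1), (1, 2, 15, 0, 0),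
  (1, 2, 23, 1, 0), (1, 3, 12, 0, 1), (1, 3, 22, 1, 1), (1, 4, 16, 1, 1), (1, 4, 20, 0, 1),
  (1, 5, 21, 0, 1), (1, 5, 25, 1, 1), (1, 6, 17, 0, 0), (1, 6, 24, 1, 0), (1, 7, 13, 1, 1),
  (1, 7, 21, 0, 0), (1, 8, 11, 0, 1), (1, 8, 14, 1, 0), (1, 9, 18, 0, 0), (1, 9, 23, 1, 1),
  (1, 10, 12, 0, 0), (1, 10, 18, 1, 1), (1, 11, 22, 0, 0), (1, 13, 17, 0, 1), (1, 14, 19, 1, 0),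
  (1, 15, 16, 1, 0), (1, 19, 25, 1, 0), (1, 20, 24, 0, 1), (2, 3, 5, 1, 0), (2, 3, 19, 0, 0),
  (2, 4, 10, 1, 1), (2, 4, 11, 0, 1), (2, 5, 12, 1, 1), (2, 6, 7, 1, 0), (2, 6, 12, 0, 0),
  (2, 7, 25, 1, 0), (2, 8, 17, 1, 1), (2, 8, 18, 0, 0), (2, 9, 22, 0, 0), (2, 9, 24, 1, 1),
  (2, 10, 22, 0, 1), (2, 11, 16, 0, 0), (2, 13, 21, 0, 1), (2, 13, 24, 1, 0), (2, 14, 20, 0, 0),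
  (2, 15, 23, 1, 0), (2, 16, 17, 1, 0), (2, 18, 19, 1, 1), (2, 20, 21, 1, 0), (3, 4, 7, 0, 1),
  (3, 4, 14, 1, 1), (3, 5, 8, 0, 0), (3, 6, 23, 0, 1), (3, 7, 15, 0, 1), (3, 8, 25, 1, 1),
  (3, 9, 13, 1, 1), (3, 9, 20, 0, 0), (3, 10, 11, 1, 0), (3, 10, 17, 0, 0), (3, 11, 24, 1, 1),
  (3, 12, 21, 0, 0), (3, 13, 18, 0, 0), (3, 14, 16, 0, 0), (3, 15, 18, 0, 1), (3, 16, 25, 1, 0),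
  (3, 17, 24, 1, 0), (3, 19, 20, 1, 1), (3, 21, 22, 1, 1), (4, 5, 9, 1, 1), (4, 5, 15, 0, 0),
  (4, 6, 10, 0, 1), (4, 6, 18, 1, 1), (4, 7, 24, 0, 0), (4, 8, 13, 0, 1), (4, 8, 21, 1, 1),
  (4, 9, 11, 0, 0), (4, 12, 13, 1, 0), (4, 12, 17, 0, 0), (4, 14, 22, 1, 1), (4, 15, 20, 1, 0),
  (4, 16, 17, 1, 1), (4, 18, 24, 0, 1), (4, 19, 22, 1, 0), (4, 19, 25, 0, 0), (4, 23, 25, 0, 1),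
  (5, 6, 22, 0, 1), (5, 6, 25, 1, 1), (5, 7, 12, 0, 1), (5, 7, 20, 1, 1), (5, 8, 17, 1, 0),
  (5, 9, 16, 1, 0), (5, 10, 14, 0, 1), (5, 10, 24, 1, 0), (5, 11, 18, 1, 1), (5, 11, 23, 0, 0),
  (5, 13, 14, 0, 0), (5, 16, 21, 1, 0), (5, 17, 19, 1, 0), (5, 18, 20, 0, 0), (5, 19, 24, 1, 1),
  (5, 22, 23, 0, 1), (6, 7, 11, 0, 0), (6, 8, 20, 0, 0), (6, 9, 16, 0, 0), (6, 9, 22, 1, 0),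
  (6, 10, 12, 0, 1), (6, 11, 14, 1, 1), (6, 13, 15, 0, 0), (6, 13, 19, 1, 1), (6, 14, 25, 0, 1),
  (6, 15, 24, 1, 0), (6, 16, 18, 1, 1), (6, 17, 21, 1, 1), (6, 19, 20, 0, 1), (6, 21, 23, 0, 0),
  (7, 8, 9, 0, 1), (7, 8, 23, 1, 1), (7, 9, 14, 0, 0), (7, 10, 18, 1, 0), (7, 10, 25, 0, 0),
  (7, 11, 20, 1, 1), (7, 13, 22, 1, 0), (7, 14, 17, 1, 1), (7, 15, 16, 0, 0), (7, 16, 24, 1, 1),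
  (7, 17, 23, 0, 0), (7, 18, 22, 1, 1), (7, 19, 21, 1, 1), (8, 9, 23, 0, 1), (8, 10, 13, 1, 0),
  (8, 10, 20, 0, 1), (8, 11, 25, 0, 1), (8, 12, 24, 1, 0), (8, 14, 19, 0, 0), (8, 15, 18, 1, 1),
  (8, 15, 19, 0, 1), (8, 16, 21, 1, 1), (8, 16, 22, 0, 0), (8, 22, 24, 1, 1), (9, 10, 19, 0, 0),
  (9, 10, 21, 1, 1), (9, 11, 25, 1, 1), (9, 12, 15, 0, 1), (9, 12, 19, 1, 1), (9, 13, 25, 1, 0),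
  (9, 15, 17, 0, 0), (9, 17, 18, 1, 1), (9, 20, 24, 1, 1), (10, 13, 23, 0, 0), (10, 14, 17, 0, 1),
  (10, 15, 20, 0, 0), (10, 15, 25, 1, 1), (10, 16, 22, 1, 0), (10, 19, 23, 1, 1),
  (10, 21, 24, 1, 0), (11, 12, 14, 0, 1), (11, 12, 23, 1, 1), (11, 13, 15, 0, 1),
  (11, 15, 19, 0, 0), (11, 16, 19, 1, 1), (11, 17, 21, 0, 1), (11, 17, 24, 1, 1),
  (11, 18, 21, 1, 0), (11, 20, 22, 1, 1), (12, 13, 18, 0, 1), (12, 14, 16, 0, 1),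
  (12, 15, 24, 0, 0), (12, 16, 19, 0, 1), (12, 17, 22, 1, 0), (12, 18, 25, 0, 1),
  (12, 20, 22, 0, 1), (12, 20, 23, 1, 1), (12, 21, 25, 1, 0), (13, 14, 22, 1, 0),
  (13, 16, 23, 0, 1), (13, 16, 24, 1, 0), (13, 17, 20, 0, 0), (13, 19, 21, 1, 0),
  (13, 20, 25, 1, 0), (14, 15, 21, 1, 1), (14, 15, 23, 0, 0), (14, 18, 20, 0, 1),
  (14, 18, 23, 1, 1), (14, 21, 24, 0, 0), (14, 24, 25, 1, 0), (15, 17, 25, 1, 1),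
  (15, 21, 22, 1, 0), (16, 18, 23, 1, 0), (16, 20, 25, 0, 0), (17, 19, 23, 0, 1),
  (17, 22, 25, 0, 1), (18, 19, 22, 1, 1), (18, 21, 25, 0, 0), (20, 21, 23, 0, 1),
  (22, 23, 24, 0, 1), (23, 24, 25, 0, 0)]

/-- Base blocks of a packing of order 26 with the restriction on the first five groups. -/
def starRows26 : List (ℕ × ℕ × ℕ × ℕ × ℕ) := [
  (0, 1, 17, 0, 1), (0, 2, 19, 0, 1), (0, 3, 7, 0, 1), (0, 4, 21, 0, 0), (0, 5, 6, 0, 1),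
  (0, 5, 24, 1, 0), (0, 6, 23, 0, 1), (0, 7, 10, 0, 0), (0, 8, 11, 0, 0), (0, 8, 20, 1, 0),
  (0, 9, 16, 0, 0), (0, 9, 25, 1, 0), (0, 10, 15, 1, 0), (0, 11, 21, 1, 1), (0, 12, 14, 1, 1),
  (0, 12, 18, 0, 0), (0, 13, 24, 0, 1), (0, 13, 25, 1, 1), (0, 14, 18, 0, 1), (0, 15, 17, 1, 0),
  (0, 16, 20, 1, 1), (0, 19, 22, 0, 0), (0, 22, 23, 1, 0), (1, 2, 6, 0, 0), (1, 3, 9, 0, 0),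
  (1, 4, 9, 0, 1), (1, 5, 15, 0, 0), (1, 5, 24, 1, 1), (1, 6, 10, 1, 1), (1, 7, 19, 0, 0),
  (1, 7, 21, 1, 1), (1, 8, 22, 1, 0), (1, 8, 25, 0, 0), (1, 10, 12, 0, 0), (1, 11, 19, 1, 1),
  (1, 11, 25, 0, 1), (1, 12, 20, 1, 1), (1, 13, 14, 0, 1), (1, 13, 22, 1, 1), (1, 14, 16, 0, 1),
  (1, 15, 24, 1, 0), (1, 16, 18, 0, 0), (1, 17, 23, 0, 0), (1, 18, 21, 1, 0), (1, 20, 23, 0, 1),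
  (2, 3, 12, 0, 0), (2, 4, 24, 0, 0), (2, 5, 9, 1, 0), (2, 5, 23, 0, 1), (2, 6, 16, 1, 0),
  (2, 7, 11, 1, 0), (2, 7, 20, 0, 1), (2, 8, 10, 1, 0), (2, 8, 23, 0, 0), (2, 9, 12, 1, 1),
  (2, 10, 18, 1, 1), (2, 11, 13, 1, 1), (2, 13, 15, 0, 1), (2, 14, 24, 0, 1), (2, 14, 25, 1, 0),
  (2, 15, 19, 0, 0), (2, 16, 17, 1, 0), (2, 17, 18, 1, 0), (2, 20, 22, 0, 1), (2, 21, 22, 0, 0),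
  (2, 21, 25, 1, 1), (3, 4, 21, 0, 1), (3, 5, 13, 0, 0), (3, 5, 19, 1, 0), (3, 6, 17, 1, 1),
  (3, 6, 25, 0, 0), (3, 7, 22, 0, 0), (3, 8, 13, 0, 1), (3, 8, 16, 1, 1), (3, 9, 15, 1, 1),
  (3, 10, 22, 1, 1), (3, 10, 23, 0, 0), (3, 11, 18, 1, 0), (3, 11, 23, 0, 1), (3, 12, 24, 1, 1),
  (3, 14, 15, 1, 0), (3, 14, 20, 0, 1), (3, 16, 19, 0, 1), (3, 17, 25, 0, 1), (3, 18, 20, 1, 0),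
  (3, 21, 24, 0, 0), (4, 5, 16, 1, 1), (4, 5, 19, 0, 0), (4, 6, 8, 0, 1), (4, 6, 10, 1, 0),
  (4, 7, 15, 1, 0), (4, 7, 17, 0, 1), (4, 8, 11, 0, 1), (4, 9, 22, 0, 1), (4, 10, 25, 1, 0),
  (4, 11, 14, 0, 1), (4, 12, 14, 1, 0), (4, 12, 23, 0, 1), (4, 13, 17, 1, 0), (4, 13, 20, 0, 0),
  (4, 15, 18, 1, 0), (4, 16, 23, 0, 0), (4, 18, 25, 1, 1), (4, 19, 22, 1, 0), (4, 20, 24, 1, 1),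
  (5, 7, 9, 1, 0), (5, 7, 23, 0, 0), (5, 8, 14, 0, 0), (5, 10, 11, 1, 0), (5, 10, 17, 0, 0),
  (5, 11, 25, 1, 1), (5, 12, 13, 0, 1), (5, 12, 18, 1, 0), (5, 14, 22, 1, 0), (5, 15, 25, 1, 0),
  (5, 16, 21, 1, 0), (5, 17, 18, 1, 1), (5, 20, 21, 0, 1), (5, 20, 22, 1, 1), (6, 7, 9, 1, 1),
  (6, 8, 14, 0, 1), (6, 9, 12, 0, 1), (6, 11, 16, 1, 0), (6, 11, 22, 0, 1), (6, 12, 21, 0, 1),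
  (6, 13, 19, 1, 0), (6, 13, 25, 0, 1), (6, 14, 21, 0, 0), (6, 15, 18, 1, 1), (6, 15, 24, 0, 0),
  (6, 17, 20, 1, 0), (6, 18, 22, 0, 0), (6, 19, 20, 1, 1), (6, 23, 24, 0, 1), (7, 8, 18, 1, 0),
  (7, 10, 20, 1, 0), (7, 11, 21, 0, 1), (7, 12, 13, 1, 1), (7, 12, 25, 0, 0), (7, 13, 14, 0, 0),
  (7, 14, 16, 1, 1), (7, 15, 16, 0, 0), (7, 17, 24, 0, 0), (7, 18, 24, 1, 1), (7, 19, 25, 1, 1),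
  (7, 22, 23, 1, 1), (8, 9, 15, 0, 1), (8, 9, 19, 1, 1), (8, 10, 17, 0, 1), (8, 12, 22, 1, 0),
  (8, 12, 24, 0, 1), (8, 13, 24, 0, 0), (8, 15, 20, 0, 0), (8, 16, 21, 1, 1), (8, 17, 21, 0, 0),
  (8, 18, 23, 0, 1), (8, 19, 25, 0, 1), (9, 10, 11, 1, 1), (9, 10, 14, 0, 1), (9, 11, 20, 0, 1),
  (9, 13, 17, 1, 1), (9, 13, 18, 0, 0), (9, 14, 23, 0, 0), (9, 16, 20, 1, 0), (9, 17, 24, 0, 1),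
  (9, 18, 19, 1, 1), (9, 21, 23, 0, 1), (9, 21, 25, 1, 0), (9, 22, 24, 0, 0), (10, 12, 23, 1, 1),
  (10, 13, 18, 0, 1), (10, 13, 21, 1, 1), (10, 14, 15, 0, 0), (10, 16, 19, 0, 0),
  (10, 16, 24, 1, 1), (10, 19, 24, 1, 0), (10, 20, 25, 0, 0), (10, 21, 22, 0, 1),
  (11, 12, 17, 1, 1), (11, 12, 19, 0, 1), (11, 13, 15, 1, 1), (11, 14, 20, 0, 0),
  (11, 15, 22, 0, 0), (11, 16, 17, 0, 0), (11, 18, 24, 0, 1), (11, 23, 24, 0, 0),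
  (12, 15, 16, 0, 1), (12, 15, 22, 1, 0), (12, 16, 25, 0, 1), (12, 17, 20, 1, 1),
  (12, 19, 21, 0, 0), (13, 16, 22, 0, 1), (13, 16, 23, 1, 0), (13, 19, 23, 0, 1),
  (13, 20, 21, 1, 1), (14, 17, 19, 0, 0), (14, 17, 22, 1, 0), (14, 18, 19, 0, 1),
  (14, 21, 24, 1, 0), (14, 23, 25, 1, 0), (15, 17, 21, 0, 1), (15, 19, 21, 1, 0),
  (15, 20, 23, 1, 1), (15, 23, 25, 0, 0), (16, 18, 22, 1, 0), (16, 24, 25, 1, 0),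
  (17, 19, 23, 1, 1), (17, 22, 25, 0, 0), (18, 20, 25, 0, 1), (18, 21, 23, 0, 0),
  (19, 20, 24, 1, 0), (22, 24, 25, 1, 1)]

theorem hasPacking_holeRel_14 : HasPacking (holeRel 14) 120 :=
  hasPacking_holeRel_of_rows holeRows14 (by decide +kernel) (by decide +kernel)

theorem hasPacking_starRel_14 : HasPacking (starRel 14) 112 :=
  hasPacking_starRel_of_rows starRows14 (by decide +kernel) (by decide +kernel)

set_option maxRecDepth 10000 in
theorem hasPacking_holeRel_26 : HasPacking (holeRel 26) 432 :=
  hasPacking_holeRel_of_rows holeRows26 (by decide +kernel) (by decide +kernel)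

set_option maxRecDepth 10000 in
theorem hasPacking_starRel_26 : HasPacking (starRel 26) 424 :=
  hasPacking_starRel_of_rows starRows26 (by decide +kernel) (by decide +kernel)

end SmallOrders

section GroupDivisible

/-- The affine quasigroup `a, b ↦ ω a + ω² b` of the field with four elements, written in
coordinates; it commutes with the simultaneous shift of second coordinates. -/
def affineMul (a b : ZMod 2 × ZMod 2) : ZMod 2 × ZMod 2 :=
  (a.2 + b.1 + b.2, a.1 + a.2 + b.1)

theorem affineMul_left_cancel {a b c : ZMod 2 × ZMod 2} (h : affineMul a b = affineMul a c) :
    b = c := by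
  revert a b c; decide

theorem affineMul_right_cancel {a b c : ZMod 2 × ZMod 2} (h : affineMul a c = affineMul b c) :
    a = b := by
  revert a b c; decide

theorem affineMul_shift (a b : ZMod 2 × ZMod 2) :
    affineMul (a.1, a.2 + 1) (b.1, b.2 + 1) = ((affineMul a b).1, (affineMul a b).2 + 1) := by
  revert a b; decide

theorem natCast_succ_inj {m h : ℕ} (hm : m = 2 * h + 1) {d e : Fin h}
    (hde : ((d + 1 : ℕ) : ZMod m) = ((e + 1 : ℕ) : ZMod m)) : d = e := by
  rw [ZMod.natCast_eq_natCast_iff'] at hde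
  rw [Nat.mod_eq_of_lt (by omega), Nat.mod_eq_of_lt (by omega)] at hde
  exact Fin.ext (by omega)

theorem natCast_succ_add_ne_zero {m h : ℕ} (hm : m = 2 * h + 1) (d e : Fin h) :
    ((d + 1 : ℕ) : ZMod m) + ((e + 1 : ℕ) : ZMod m) ≠ 0 := by
  rw [← Nat.cast_add, Ne, ZMod.natCast_eq_zero_iff]
  intro hdvd
  have := Nat.le_of_dvd (by omega) hdvd
  omega

theorem two_mul_cancel {m h : ℕ} (hm : m = 2 * h + 1) {y z : ZMod m} (hyz : y + y = z + z) :
    y = z := by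
  have hc : (2 * (h : ZMod m) + 1) = 0 := by
    have := ZMod.natCast_self m
    rw [hm] at this ⊢
    exact_mod_cast this
  linear_combination (y - z) * hc - (h : ZMod m) * hyz

/-- Bose's construction over `ZMod m`, `m` odd, with every point inflated by the affine quasigroup
of order four and the group `ZMod n`. -/
theorem hasPacking_bose (m h n : ℕ) [NeZero m] [NeZero n] (hm : m = 2 * h + 1) :
    HasPacking (V := ZMod m × ZMod 3 × ZMod 2 × ZMod n) (fun p q => p.1.1 ≠ q.1.1)
      (m * (h * (3 * ((4 * n) * (4 * n))))) := by
  have hcard : Fintype.card (ZMod m × Fin h × ZMod 3 ×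
      (((ZMod 2 × ZMod 2) × ZMod n) × ((ZMod 2 × ZMod 2) × ZMod n))) =
      m * (h * (3 * ((4 * n) * (4 * n)))) := by
    simp [ZMod.card]
  rw [← hcard]
  refine HasPacking.of_family (fun t =>
    ![((t.1 - ((t.2.1 + 1 : ℕ) : ZMod m), t.2.2.1, t.2.2.2.1.1.1, t.2.2.2.1.2), t.2.2.2.1.1.2),
      ((t.1 + ((t.2.1 + 1 : ℕ) : ZMod m), t.2.2.1, t.2.2.2.2.1.1, t.2.2.2.2.2), t.2.2.2.2.1.2),
      ((t.1, t.2.2.1 + 1, (affineMul t.2.2.2.1.1 t.2.2.2.2.1).1, t.2.2.2.1.2 + t.2.2.2.2.2),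
        (affineMul t.2.2.2.1.1 t.2.2.2.2.1).2)]) (fun p => by simp) ?_ ?_ ?_
  · rintro ⟨z, d, c, a, b⟩
    have h₁ := natCast_succ_add_ne_zero hm d d
    have h₂ : ((d + 1 : ℕ) : ZMod m) ≠ 0 := fun h0 => h₁ (by rw [h0, add_zero])
    generalize ((d + 1 : ℕ) : ZMod m) = δ at h₁ h₂
    have h₃ : z - δ ≠ z + δ := fun h => h₁ (by linear_combination -h)
    have h₄ : z - δ ≠ z := fun h => h₂ (by linear_combination -h)
    have h₅ : z + δ ≠ z := fun h => h₂ (by linear_combination h)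
    intro i j hij
    fin_cases i <;> fin_cases j <;>
      first | exact absurd rfl hij | exact h₃ | exact h₃.symm | exact h₄ | exact h₄.symm |
        exact h₅ | exact h₅.symm
  · rintro ⟨z, d, c, ⟨⟨a₁, a₂⟩, a₃⟩, ⟨⟨b₁, b₂⟩, b₃⟩⟩ ⟨z', d', c', ⟨⟨a₁', a₂'⟩, a₃'⟩, ⟨⟨b₁', b₂'⟩, b₃'⟩⟩
      i j i' j' hij hij' hi hj
    have hd := @natCast_succ_inj m h hm d d'
    have hd' := natCast_succ_add_ne_zero hm d d'
    generalize ((d + 1 : ℕ) : ZMod m) = δ at hd hd' hi hj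
    generalize ((d' + 1 : ℕ) : ZMod m) = δ' at hd hd' hi hj
    have hc₁ : ∀ {y y' : ZMod 3}, y = y' → y ≠ y' + 1 := by decide
    have hc₂ : ∀ {y y' : ZMod 3}, y = y' → y + 1 ≠ y' := by decide
    have hc₃ : ∀ {y y' : ZMod 3}, y = y' + 1 → y + 1 ≠ y' := by decide
    fin_cases i <;> fin_cases j <;> (try exact absurd rfl hij) <;>
      fin_cases i' <;> fin_cases j' <;> (try exact absurd rfl hij') <;>
      (simp only [Prod.mk.injEq, Fin.zero_eta, Fin.mk_one, Fin.reduceFinMk, Matrix.cons_val,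
        Matrix.cons_val_zero, Matrix.cons_val_one] at hi hj
       obtain ⟨⟨e₁, e₂, e₃, e₄⟩, e₅⟩ := hi
       obtain ⟨⟨f₁, f₂, f₃, f₄⟩, f₅⟩ := hj) <;>
      (first
        | exact absurd f₂ (hc₁ e₂) | exact absurd f₂ (hc₂ e₂) | exact absurd f₂ (hc₃ e₂)
        | exact absurd e₂ (hc₁ f₂) | exact absurd e₂ (hc₂ f₂) | exact absurd e₂ (hc₃ f₂)
        | skip) <;>
      (have hz : z = z' := by
        first | exact e₁ | exact f₁ | exact two_mul_cancel hm (by linear_combination e₁ + f₁)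
       subst hz) <;>
      (first
        | exact absurd (by linear_combination e₁) hd' | exact absurd (by linear_combination -e₁) hd'
        | exact absurd (by linear_combination f₁) hd' | exact absurd (by linear_combination -f₁) hd'
        | skip) <;>
      (have hδ : δ = δ' := by
        first
          | linear_combination e₁ | linear_combination -e₁
          | linear_combination f₁ | linear_combination -f₁
       obtain rfl := hd hδ
       have hcc : c = c' := by first | exact e₂ | exact f₂
       subst hcc) <;>
      first
        | (subst e₃ e₄ e₅ f₃ f₄ f₅; rfl)
        | (subst e₃ e₄ e₅
           have h₁ := affineMul_left_cancel (Prod.ext f₃ f₅)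
           have h₂ := add_left_cancel f₄
           rw [h₁, h₂])
        | (subst e₃ e₄ e₅
           have h₁ := affineMul_right_cancel (Prod.ext f₃ f₅)
           have h₂ := add_right_cancel f₄
           rw [h₁, h₂])
        | (subst f₃ f₄ f₅
           have h₁ := affineMul_left_cancel (Prod.ext e₃ e₅)
           have h₂ := add_left_cancel e₄
           rw [h₁, h₂])
        | (subst f₃ f₄ f₅
           have h₁ := affineMul_right_cancel (Prod.ext e₃ e₅)
           have h₂ := add_right_cancel e₄
           rw [h₁, h₂])
  · rintro ⟨z, d, c, a, b⟩
    refine ⟨(z, d, c, ((a.1.1, a.1.2 + 1), a.2), ((b.1.1, b.1.2 + 1), b.2)), fun i => ?_⟩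
    fin_cases i
    · rfl
    · rfl
    · simp [affineMul_shift]

/-- The blocks of the affine plane of order three missing a fixed point, as triples on
`ZMod 4 × ZMod 2` whose groups are the lines through that point: coordinates of
`{x, x + 1, x + 3}` in `ZMod 8`. -/
def octagonBlock (x : Fin 4 × ZMod 2) : Fin 3 → Fin 4 × ZMod 2 :=
  ![x, (x.1 + 1, x.2 + if x.1 = 3 then 1 else 0), (x.1 + 3, x.2 + if x.1 = 0 then 0 else 1)]

theorem octagonBlock_unique : ∀ x y : Fin 4 × ZMod 2, ∀ i j i' j' : Fin 3, i ≠ j → i' ≠ j' →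
    octagonBlock x i = octagonBlock y i' → octagonBlock x j = octagonBlock y j' →
    x = y ∧ i = i' ∧ j = j' := by
  decide +kernel

theorem octagonBlock_ne : ∀ x : Fin 4 × ZMod 2, ∀ i j : Fin 3, i ≠ j →
    (octagonBlock x i).1 ≠ (octagonBlock x j).1 := by
  decide +kernel

theorem hasPacking_four (n : ℕ) [NeZero n] :
    HasPacking (V := Fin 4 × ZMod n) (fun p q => p.1.1 ≠ q.1.1) (8 * (n * n)) := by
  have hcard : Fintype.card ((Fin 4 × ZMod 2) × ZMod n × ZMod n) = 8 * (n * n) := by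
    simp [ZMod.card]
  rw [← hcard]
  refine HasPacking.of_family (fun t i => (((octagonBlock t.1 i).1,
    (![t.2.1, t.2.2, t.2.1 + t.2.2] : Fin 3 → ZMod n) i), (octagonBlock t.1 i).2))
    (fun p => by simp) ?_ ?_ ?_
  · rintro ⟨x, -⟩ i j hij
    exact octagonBlock_ne x i j hij
  · rintro ⟨x, a, b⟩ ⟨x', a', b'⟩ i j i' j' hij hij' hi hj
    simp only [Prod.mk.injEq] at hi hj
    obtain ⟨rfl, rfl, rfl⟩ := octagonBlock_unique x x' i j i' j' hij hij'
      (Prod.ext hi.1.1 hi.2) (Prod.ext hj.1.1 hj.2)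
    have h₁ := hi.1.2
    have h₂ := hj.1.2
    fin_cases i <;> fin_cases j <;> simp_all
  · rintro ⟨x, a, b⟩
    refine ⟨((x.1, x.2 + 1), a, b), fun i => ?_⟩
    fin_cases i <;> simp [octagonBlock, add_right_comm]

/-- Two points of `Fin u` other than `0` and `1`, in different blocks of length `n`. -/
def groupRel (n u : ℕ) (p q : Fin u × ZMod 2) : Prop :=
  2 ≤ p.1.val ∧ 2 ≤ q.1.val ∧ (p.1.val - 2) / n ≠ (q.1.val - 2) / n

theorem HasPacking.toFin {I F : Type*} [DecidableEq I] [DecidableEq F] [Fintype I] [Fintype F]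
    {N m n u : ℕ} (h : HasPacking (V := I × F) (fun p q => p.1.1 ≠ q.1.1) N)
    (hI : Fintype.card I = m) (hF : Fintype.card F = n) (hu : u = m * n + 2) :
    HasPacking (groupRel n u) N := by
  subst hu
  let e := Fintype.equivFinOfCardEq hI
  let f := Fintype.equivFinOfCardEq hF
  refine h.map (f := fun x => ⟨finProdFinEquiv (e x.1, f x.2) + 2, by omega⟩) ?_ ?_
  · intro x y hxy
    have := finProdFinEquiv.injective (Fin.ext (by simpa using hxy :
      (finProdFinEquiv (e x.1, f x.2)).val = (finProdFinEquiv (e y.1, f y.2)).val))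
    simp only [Prod.mk.injEq, e.injective.eq_iff, f.injective.eq_iff] at this
    exact Prod.ext this.1 this.2
  · intro p q hpq
    have key : ∀ x : I × F, (finProdFinEquiv (e x.1, f x.2)).val / n = (e x.1).val := by
      intro x
      rw [finProdFinEquiv_apply_val]
      rw [Nat.add_mul_div_left _ _ (f x.2).pos, Nat.div_eq_of_lt (f x.2).2, zero_add]
    refine ⟨by simp, by simp, ?_⟩
    simp only [Nat.add_sub_cancel, key]
    exact fun h => hpq (e.injective (Fin.ext h))

theorem hasPacking_groupRel {m j u : ℕ} (hj : 1 ≤ j) (hm : m = 4 ∨ Odd m)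
    (hu : u = m * (12 * j) + 2) :
    HasPacking (groupRel (12 * j) u) (96 * (j * j) * (m * (m - 1))) := by
  rcases hm with rfl | ⟨h, rfl⟩
  · have : NeZero (12 * j) := ⟨by omega⟩
    convert (hasPacking_four (12 * j)).toFin (by simp) (ZMod.card _) hu using 1
    ring
  · have : NeZero (2 * j) := ⟨by omega⟩
    convert (hasPacking_bose (2 * h + 1) h (2 * j) rfl).toFin (ZMod.card _)
      (n := 12 * j) (by simp [ZMod.card]; ring) hu using 1
    rw [Nat.add_sub_cancel]
    ring

end GroupDivisible

section Filling

/-- Embed a packing's hole and one of its groups of size `n` as the hole and the `g`-th group. -/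
theorem HasPacking.translate {n m u g N : ℕ} (hu : u = m * n + 2) (hg : g < m)
    (h : HasPacking (holeRel (n + 2)) N) :
    HasPacking (fun p q : Fin u × ZMod 2 => holeRel u p q ∧
      (2 ≤ p.1.val → (p.1.val - 2) / n = g) ∧ (2 ≤ q.1.val → (q.1.val - 2) / n = g)) N := by
  subst hu
  have hle : n * g + n ≤ m * n := by
    rw [mul_comm m n, ← Nat.mul_succ]
    exact Nat.mul_le_mul_left n hg
  let f : Fin (n + 2) → Fin (m * n + 2) := fun x =>
    ⟨if x.val < 2 then x.val else x.val + n * g, by split_ifs <;> omega⟩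
  have hf : ∀ x, (f x).val = if x.val < 2 then x.val else x.val + n * g := fun x => rfl
  have hlow : ∀ x, (f x).val < 2 ↔ x.val < 2 := by
    intro x
    rw [hf]
    split_ifs <;> omega
  have hinj : Function.Injective f := by
    intro x y hxy
    have hxy' := congrArg Fin.val hxy
    rw [hf, hf] at hxy'
    refine Fin.ext ?_
    split_ifs at hxy' <;> omega
  have hdiv : ∀ x, 2 ≤ (f x).val → ((f x).val - 2) / n = g := by
    intro x hx
    have hx' : ¬ x.val < 2 := fun h2 => by have := (hlow x).2 h2; omega
    rw [hf, if_neg hx', Nat.sub_add_comm (by omega), Nat.add_mul_div_left _ _ (by omega),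
      Nat.div_eq_of_lt (by omega), zero_add]
  refine h.map hinj fun p q hpq => ⟨⟨fun h' => hpq.1 (hinj h'), ?_⟩, hdiv _, hdiv _⟩
  simpa only [hlow] using hpq.2

/-- Fill the groups of a group divisible packing, the first of them by a prescribed packing. -/
theorem HasPacking.fill {n m u N₀ N₁ N₂ : ℕ} (hu : u = m * n + 2)
    (hnu : n + 2 ≤ u)
    {S : Fin (n + 2) × ZMod 2 → Fin (n + 2) × ZMod 2 → Prop}
    {R : Fin u × ZMod 2 → Fin u × ZMod 2 → Prop}
    (hS : HasPacking S N₀) (hP : HasPacking (holeRel (n + 2)) N₁)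
    (hG : HasPacking (groupRel n u) N₂)
    (hSR : ∀ p q, S p q → R (Fin.castLE hnu p.1, p.2) (Fin.castLE hnu q.1, q.2))
    (hR : ∀ p q, p.1 ≠ q.1 → ¬ (p.1.val < n + 2 ∧ q.1.val < n + 2) → R p q) :
    HasPacking R (N₀ + ((m - 1) * N₁ + N₂)) := by
  have hdiv : ∀ x : ℕ, x < n + 2 → 2 ≤ x → (x - 2) / n = 0 := fun x hx hx2 =>
    Nat.div_eq_of_lt (by omega)
  have h₀ : HasPacking (fun p q : Fin u × ZMod 2 =>
      R p q ∧ p.1.val < n + 2 ∧ q.1.val < n + 2) N₀ :=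
    hS.map (Fin.castLE_injective hnu) fun p q hpq => ⟨hSR p q hpq, p.1.2, q.1.2⟩
  have h₁ := HasPacking.biUnion (Finset.Ico 1 m) (R := fun g (p q : Fin u × ZMod 2) =>
    holeRel u p q ∧ (2 ≤ p.1.val → (p.1.val - 2) / n = g) ∧
      (2 ≤ q.1.val → (q.1.val - 2) / n = g))
    (fun g hg => hP.translate hu (Finset.mem_Ico.1 hg).2) (by
      rintro g - g' - hgg' p q ⟨⟨-, hpq⟩, hp, hq⟩ ⟨-, hp', hq'⟩
      by_cases h2 : 2 ≤ p.1.val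
      · exact hgg' ((hp h2).symm.trans (hp' h2))
      · have h2' : 2 ≤ q.1.val := by omega
        exact hgg' ((hq h2').symm.trans (hq' h2')))
  rw [Nat.card_Ico] at h₁
  have h₂ := h₁.union hG (by
    rintro p q ⟨g, -, -, hp, hq⟩ ⟨hp2, hq2, hne⟩
    exact hne ((hp hp2).trans (hq hq2).symm))
  refine (h₀.union h₂ ?_).mono ?_
  · rintro p q ⟨-, hp, hq⟩ (⟨g, hg, ⟨-, hpq⟩, hp', hq'⟩ | ⟨hp2, hq2, hne⟩)
    · have hg1 := (Finset.mem_Ico.1 hg).1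
      by_cases h2 : 2 ≤ p.1.val
      · have := hp' h2
        rw [hdiv _ hp h2] at this
        omega
      · have h2' : 2 ≤ q.1.val := by omega
        have := hq' h2'
        rw [hdiv _ hq h2'] at this
        omega
    · exact hne ((hdiv _ hp hp2).trans (hdiv _ hq hq2).symm)
  · rintro p q (⟨h, -, -⟩ | ⟨g, hg, ⟨hne, hpq⟩, hp', hq'⟩ | ⟨hp2, hq2, hne⟩)
    · exact h
    · refine hR p q hne ?_
      rintro ⟨hp, hq⟩
      have hg1 := (Finset.mem_Ico.1 hg).1
      by_cases h2 : 2 ≤ p.1.val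
      · have := hp' h2
        rw [hdiv _ hp h2] at this
        omega
      · have h2' : 2 ≤ q.1.val := by omega
        have := hq' h2'
        rw [hdiv _ hq h2'] at this
        omega
    · refine hR p q (fun h => hne (by rw [h])) ?_
      rintro ⟨hp, hq⟩
      exact hne ((hdiv _ hp hp2).trans (hdiv _ hq hq2).symm)

theorem exists_factor {k : ℕ} (hk : 3 ≤ k) :
    ∃ m j, k = m * j ∧ 1 ≤ j ∧ 3 ≤ m ∧ (m = 4 ∨ Odd m) := by
  obtain ⟨e, m, hm, rfl⟩ := Nat.exists_eq_two_pow_mul_odd (by omega : k ≠ 0)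
  by_cases h1 : m = 1
  · subst h1
    match e, hk with
    | 0, hk => simp at hk
    | 1, hk => simp at hk
    | e + 2, _ => exact ⟨4, 2 ^ e, by ring, Nat.one_le_two_pow, by norm_num, Or.inl rfl⟩
  · have := hm.pos
    have h2 : m ≠ 2 := by rintro rfl; exact absurd hm (by decide)
    exact ⟨m, 2 ^ e, mul_comm _ _, Nat.one_le_two_pow, by omega, Or.inr hm⟩

theorem hasPacking_holeRel_and_starRel (k : ℕ) (hk : 1 ≤ k) :
    HasPacking (holeRel (12 * k + 2)) (96 * (k * k) + 24 * k) ∧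
    HasPacking (starRel (12 * k + 2)) (96 * (k * k) + 24 * k - 8) := by
  induction k using Nat.strong_induction_on with
  | _ k ih =>
    rcases (by omega : k = 1 ∨ k = 2 ∨ 3 ≤ k) with rfl | rfl | hk3
    · exact ⟨hasPacking_holeRel_14, hasPacking_starRel_14⟩
    · exact ⟨hasPacking_holeRel_26, hasPacking_starRel_26⟩
    obtain ⟨m, j, rfl, hj, hm, hm'⟩ := exists_factor hk3
    have hjk : j < m * j := by nlinarith
    obtain ⟨hP, hQ⟩ := ih j hjk hj
    have hle : 12 * j + 2 ≤ 12 * (m * j) + 2 := by omega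
    have hu : 12 * (m * j) + 2 = m * (12 * j) + 2 := by ring
    have hG := hasPacking_groupRel hj hm' hu
    have hcount : 96 * (m * j * (m * j)) + 24 * (m * j) = (96 * (j * j) + 24 * j) +
        ((m - 1) * (96 * (j * j) + 24 * j) + 96 * (j * j) * (m * (m - 1))) := by
      obtain ⟨m, rfl⟩ := Nat.exists_eq_add_of_le' (by omega : 1 ≤ m)
      rw [Nat.add_sub_cancel]
      ring
    constructor
    · rw [hcount]
      refine hP.fill hu hle hP hG ?_ ?_
      · exact fun p q hpq => ⟨fun h => hpq.1 (Fin.castLE_injective hle h), hpq.2⟩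
      · exact fun p q hne hpq => ⟨hne, by omega⟩
    · rw [hcount, Nat.sub_add_comm (by nlinarith)]
      refine hQ.fill hu hle hP hG ?_ ?_
      · exact fun p q hpq => ⟨fun h => hpq.1 (Fin.castLE_injective hle h), hpq.2⟩
      · exact fun p q hne hpq => ⟨hne, fun hp hq => absurd ⟨by omega, by omega⟩ hpq⟩

end Filling

/-- For every integer u with u ≡ 2 (mod 12) and u ≥ 14, there
exists a 3-SCGDP* of type 2^{(u,5)} with (u(u−1)−14)/3 base blocks. -/
theorem exists_scgdpstar_u_5
    (u : ℕ) (hmod : u % 12 = 2) (hu : 14 ≤ u) :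
    ∃ ℬ : Finset (Finset (Fin u × ZMod 2)),
      IsSCGDPstar u 5 ((u * (u - 1) - 14) / 3) ℬ := by
  obtain ⟨k, rfl⟩ : ∃ k, u = 12 * k + 2 := ⟨u / 12, by omega⟩
  obtain ⟨ℬ, h₁, h₂, h₃, h₄, h₅⟩ := (hasPacking_holeRel_and_starRel k (by omega)).2
  refine ⟨ℬ, ?_, h₂, fun B hB p hp q hq hpq => (h₃ B hB p hp q hq hpq).1, ?_, h₅, ?_⟩
  · rw [h₁]
    have h : (12 * k + 2) * (12 * k + 2 - 1) = 144 * (k * k) + 36 * k + 2 := by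
      rw [show 12 * k + 2 - 1 = 12 * k + 1 by omega]
      ring
    rw [h]
    omega
  · intro p q hpq
    refine Finset.card_le_one.2 fun B hB C hC => ?_
    obtain ⟨hB, hpB, hqB⟩ := Finset.mem_filter.1 hB
    obtain ⟨hC, hpC, hqC⟩ := Finset.mem_filter.1 hC
    exact h₄ B hB C hC p hpB q hqB hpC hqC fun h => hpq (by rw [h])
  · rintro a b ha hb x B hB ⟨hax, hbx⟩
    have hx : x ≠ x + 1 := (by decide : ∀ y : ZMod 2, y ≠ y + 1) x
    exact hx ((h₃ B hB _ hax _ hbx fun h => hx (congrArg Prod.snd h)).2 ha hb)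
end

section
/- For every positive integer w with w ≡ 10 (mod 12), there exists a 3-SCGDP of type w^{11} with J*(11×1×w,3,1) base blocks. -/
/-- `J(u×v×w,3,1) = ⌊uv·⌊vw(u−1)/2⌋/3⌋` (floor division on naturals). -/
def J (u v w : ℕ) : ℕ := u * v * (v * w * (u - 1) / 2) / 3

/-- The improved upper bound `J*(u×v×w,3,1)`. -/
def Jstar (u v w : ℕ) : ℕ :=
  if (u = 3 ∧ v % 2 = 1 ∧ w % 4 = 0)
    ∨ (v % 2 = 1 ∧ w % 4 = 2 ∧ (u % 12 = 3 ∨ u % 12 = 6 ∨ u % 12 = 7 ∨ u % 12 = 10))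
    ∨ ((v * w) % 12 = 6 ∧ w % 4 = 2 ∧ (u % 12 = 2 ∨ u % 12 = 11))
    ∨ (((u - 1) * v ^ 2 * w) % 6 = 4 ∧ u % 3 = 2)
    ∨ (w = 2 ∧ (u * (u - 1) * v ^ 2) % 12 = 8)
  then J u v w - 1 else J u v w

/-- A `w`-cyclic `k`-GDP of type `(vw)^u` with `b` base blocks: blocks on
`I_u × I_v × Z_w` with groups `{i} × I_v × Z_w`; every block has size `k` and
meets each group in at most one point, every pair of points from distinct
groups lies in at most one block, the cyclic shift of the last coordinate
maps the block set onto itself, and (since every block orbit has length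
exactly `w`) the number of base blocks being `b` means there are `w * b`
blocks in total. -/
def IsCyclicGDP (u v w k b : ℕ)
    (ℬ : Finset (Finset (Fin u × Fin v × ZMod w))) : Prop :=
  ℬ.card = w * b ∧
  (∀ B ∈ ℬ, B.card = k) ∧
  (∀ B ∈ ℬ, ∀ p ∈ B, ∀ q ∈ B, p ≠ q → p.1 ≠ q.1) ∧
  (∀ p q : Fin u × Fin v × ZMod w, p.1 ≠ q.1 →
    (ℬ.filter (fun B => p ∈ B ∧ q ∈ B)).card ≤ 1) ∧
  (∀ B ∈ ℬ, B.image (fun p => (p.1, p.2.1, p.2.2 + 1)) ∈ ℬ)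

/-- A base block `{(i, 0), (j, d), (k, d + e)}` over the group `A`. -/
structure BaseTriple (u : ℕ) (A : Type*) where
  i : Fin u
  j : Fin u
  k : Fin u
  d : A
  e : A

namespace BaseTriple

variable {u : ℕ} {A B : Type*}

/-- The triple contains points in the groups `p` and `q` with difference `x`. -/
def Covers [Add A] (T : BaseTriple u A) (p q : Fin u) (x : A) : Prop :=
  (p = T.i ∧ q = T.j ∧ x = T.d) ∨ (p = T.j ∧ q = T.k ∧ x = T.e) ∨
    (p = T.i ∧ q = T.k ∧ x = T.d + T.e)

/-- The three groups are listed in increasing order. -/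
def Sorted (T : BaseTriple u A) : Prop := T.i < T.j ∧ T.j < T.k

/-- Apply a map to the differences of a triple. -/
def map (f : A → B) (T : BaseTriple u A) : BaseTriple u B := ⟨T.i, T.j, T.k, f T.d, f T.e⟩

theorem covers_map_iff [Add A] [Add B] (f : A ≃+ B) (T : BaseTriple u A) (p q : Fin u) (x : B) :
    (T.map f).Covers p q x ↔ T.Covers p q (f.symm x) := by
  simp only [Covers, map, ← map_add, AddEquiv.symm_apply_eq]

/-- The translate by `s` of a base triple, as a block. -/
def block {w : ℕ} (T : BaseTriple u (ZMod w)) (s : ZMod w) :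
    Finset (Fin u × Fin 1 × ZMod w) :=
  {(T.i, 0, s), (T.j, 0, T.d + s), (T.k, 0, T.d + T.e + s)}

theorem mem_block {w : ℕ} {T : BaseTriple u (ZMod w)} {s : ZMod w}
    {p : Fin u × Fin 1 × ZMod w} :
    p ∈ T.block s ↔ (p.1 = T.i ∧ p.2.2 = s) ∨ (p.1 = T.j ∧ p.2.2 = T.d + s) ∨
      (p.1 = T.k ∧ p.2.2 = T.d + T.e + s) := by
  obtain ⟨a, b, c⟩ := p
  simp [block, Subsingleton.elim b 0]

theorem Sorted.eq_shift {w : ℕ} {T : BaseTriple u (ZMod w)} (h : T.Sorted) {s s' : ZMod w}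
    {p : Fin u × Fin 1 × ZMod w} (hs : p ∈ T.block s) (hs' : p ∈ T.block s') : s = s' := by
  obtain ⟨h₁, h₂⟩ := h
  rw [mem_block] at hs hs'
  rcases hs with ⟨a, b⟩ | ⟨a, b⟩ | ⟨a, b⟩ <;> rcases hs' with ⟨c, d⟩ | ⟨c, d⟩ | ⟨c, d⟩ <;>
    first
    | (exfalso; rw [a] at c; omega)
    | (rw [b] at d; simpa using d)

theorem Sorted.covers_of_mem {w : ℕ} {T : BaseTriple u (ZMod w)} (h : T.Sorted) {s : ZMod w}
    {p q : Fin u × Fin 1 × ZMod w} (hp : p ∈ T.block s) (hq : q ∈ T.block s) (hpq : p.1 < q.1) :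
    T.Covers p.1 q.1 (q.2.2 - p.2.2) := by
  obtain ⟨h₁, h₂⟩ := h
  rw [mem_block] at hp hq
  rcases hp with ⟨a, b⟩ | ⟨a, b⟩ | ⟨a, b⟩ <;> rcases hq with ⟨c, d⟩ | ⟨c, d⟩ | ⟨c, d⟩ <;>
    first
    | (exfalso; rw [a, c] at hpq; omega)
    | (rw [b, d]; simp [Covers, a, c])

theorem Sorted.card_block {w : ℕ} {T : BaseTriple u (ZMod w)} (h : T.Sorted) (s : ZMod w) :
    (T.block s).card = 3 := by
  obtain ⟨h₁, h₂⟩ := h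
  refine Finset.card_eq_three.2 ⟨_, _, _, ?_, ?_, ?_, rfl⟩ <;>
    simp only [ne_eq, Prod.mk.injEq, not_and] <;> intro h <;> omega

theorem image_block {w : ℕ} (T : BaseTriple u (ZMod w)) (s : ZMod w) :
    (T.block s).image (fun p => (p.1, p.2.1, p.2.2 + 1)) = T.block (s + 1) := by
  simp [block, Finset.image_insert, add_assoc]

end BaseTriple

/-- Base triples covering every difference at most once develop into a cyclic GDP. -/
theorem exists_isCyclicGDP_of_baseTriples {u w : ℕ} [NeZero w] {ι : Type*} [Fintype ι]
    (T : ι → BaseTriple u (ZMod w)) (hsort : ∀ a, (T a).Sorted)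
    (hcov : ∀ a b p q x, (T a).Covers p q x → (T b).Covers p q x → a = b) :
    ∃ ℬ : Finset (Finset (Fin u × Fin 1 × ZMod w)),
      IsCyclicGDP u 1 w 3 (Fintype.card ι) ℬ := by
  classical
  have key : ∀ (a b : ι) (s s' : ZMod w) (p q : Fin u × Fin 1 × ZMod w), p.1 ≠ q.1 →
      p ∈ (T a).block s → q ∈ (T a).block s → p ∈ (T b).block s' → q ∈ (T b).block s' →
      (a, s) = (b, s') := by
    have aux : ∀ (a b : ι) (s s' : ZMod w) (p q : Fin u × Fin 1 × ZMod w), p.1 < q.1 →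
        p ∈ (T a).block s → q ∈ (T a).block s → p ∈ (T b).block s' → q ∈ (T b).block s' →
        (a, s) = (b, s') := by
      intro a b s s' p q hpq h₁ h₂ h₃ h₄
      obtain rfl := hcov a b _ _ _ ((hsort a).covers_of_mem h₁ h₂ hpq)
        ((hsort b).covers_of_mem h₃ h₄ hpq)
      rw [(hsort a).eq_shift h₁ h₃]
    intro a b s s' p q hpq h₁ h₂ h₃ h₄
    rcases lt_or_gt_of_ne hpq with h | h
    · exact aux a b s s' p q h h₁ h₂ h₃ h₄
    · exact aux a b s s' q p h h₂ h₁ h₄ h₃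
  have hinj : Function.Injective fun z : ι × ZMod w => (T z.1).block z.2 := by
    rintro ⟨a, s⟩ ⟨b, s'⟩ h
    have h₁ : ((T a).i, (0 : Fin 1), s) ∈ (T a).block s := by simp [BaseTriple.mem_block]
    have h₂ : ((T a).j, (0 : Fin 1), (T a).d + s) ∈ (T a).block s := by
      simp [BaseTriple.mem_block]
    have h' : (T a).block s = (T b).block s' := h
    exact key a b s s' _ _ (hsort a).1.ne h₁ h₂ (h' ▸ h₁) (h' ▸ h₂)
  refine ⟨Finset.univ.image fun z : ι × ZMod w => (T z.1).block z.2, ?_, ?_, ?_, ?_, ?_⟩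
  · rw [Finset.card_image_of_injective _ hinj, Finset.card_univ, Fintype.card_prod, ZMod.card,
      mul_comm]
  · simp only [Finset.mem_image, Finset.mem_univ, true_and]
    rintro _ ⟨z, rfl⟩
    exact (hsort z.1).card_block z.2
  · simp only [Finset.mem_image, Finset.mem_univ, true_and]
    rintro _ ⟨z, rfl⟩ p hp q hq hpq h
    obtain ⟨h₁, h₂⟩ := hsort z.1
    apply hpq
    obtain ⟨p₁, p₂, p₃⟩ := p
    obtain ⟨q₁, q₂, q₃⟩ := q
    obtain rfl : p₁ = q₁ := h
    obtain rfl := Subsingleton.elim p₂ q₂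
    rw [BaseTriple.mem_block] at hp hq
    dsimp only at hp hq
    rcases hp with ⟨a, rfl⟩ | ⟨a, rfl⟩ | ⟨a, rfl⟩ <;>
      rcases hq with ⟨c, rfl⟩ | ⟨c, rfl⟩ | ⟨c, rfl⟩ <;>
      first
      | rfl
      | (exfalso; rw [a] at c; omega)
  · intro p q hpq
    rw [Finset.card_le_one]
    simp only [Finset.mem_filter, Finset.mem_image, Finset.mem_univ, true_and]
    rintro _ ⟨⟨⟨a, s⟩, rfl⟩, h₁, h₂⟩ _ ⟨⟨⟨b, s'⟩, rfl⟩, h₃, h₄⟩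
    have := key a b s s' p q hpq h₁ h₂ h₃ h₄
    simp only [Prod.mk.injEq] at this
    rw [this.1, this.2]
  · simp only [Finset.mem_image, Finset.mem_univ, true_and]
    rintro _ ⟨z, rfl⟩
    exact ⟨(z.1, z.2 + 1), ((T z.1).image_block z.2).symm⟩

/-- An arithmetic progression `c₁ t + c₀ + σ s`, with `s` as running variable, of differences
between the groups `p` and `q`. -/
structure Slot where
  p : Fin 5
  q : Fin 5
  c₁ : ℤ
  c₀ : ℤ
  σ : ℤ

namespace Slot

/-- The `s`-th term of the progression. -/
def val (S : Slot) (t s : ℤ) : ℤ := S.c₁ * t + S.c₀ + S.σ * s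

/-- Every term of `S` is smaller than every term of `R`. -/
def Before (S R : Slot) : Prop :=
  S.c₁ + max S.σ 0 ≤ R.c₁ + min R.σ 0 ∧ S.c₀ - max S.σ 0 < R.c₀ - min R.σ 0

/-- The terms of `S` have a parity opposite to those of `S'`. -/
def OppositeParity (S S' : Slot) : Prop :=
  S.σ % 2 = 0 ∧ S'.σ % 2 = 0 ∧ (S.c₁ - S'.c₁) % 2 = 0 ∧ (S.c₀ - S'.c₀) % 2 = 1

/-- All terms of `S` lie in the interval `[0, 6 t + 5)`. -/
def InRange (S : Slot) : Prop :=
  0 ≤ S.c₁ + min S.σ 0 ∧ 0 ≤ S.c₀ - min S.σ 0 ∧ S.c₁ + max S.σ 0 ≤ 6 ∧ S.c₀ - max S.σ 0 < 5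

instance (S S' : Slot) : Decidable (S.Before S') := inferInstanceAs (Decidable (_ ∧ _))
instance (S S' : Slot) : Decidable (S.OppositeParity S') := inferInstanceAs (Decidable (_ ∧ _))
instance (S : Slot) : Decidable S.InRange := inferInstanceAs (Decidable (_ ∧ _))

variable {S S' : Slot} {t s s' : ℤ}

theorem val_le (hs : 0 ≤ s) (hst : S.σ = 0 ∨ s < t) :
    S.val t s ≤ (S.c₁ + max S.σ 0) * t + (S.c₀ - max S.σ 0) := by
  unfold val
  rcases hst with h | h
  · simp [h]
  rcases le_total S.σ 0 with h' | h'
  · rw [max_eq_right h']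
    nlinarith
  · rw [max_eq_left h']
    nlinarith

theorem le_val (hs : 0 ≤ s) (hst : S.σ = 0 ∨ s < t) :
    (S.c₁ + min S.σ 0) * t + (S.c₀ - min S.σ 0) ≤ S.val t s := by
  unfold val
  rcases hst with h | h
  · simp [h]
  rcases le_total S.σ 0 with h' | h'
  · rw [min_eq_left h']
    nlinarith
  · rw [min_eq_right h']
    nlinarith

theorem Before.lt (h : S.Before S') (ht : 0 ≤ t) (hs : 0 ≤ s) (hst : S.σ = 0 ∨ s < t)
    (hs' : 0 ≤ s') (hst' : S'.σ = 0 ∨ s' < t) : S.val t s < S'.val t s' := by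
  have h₁ := val_le hs hst
  have h₂ := le_val hs' hst'
  have h₃ := mul_le_mul_of_nonneg_right h.1 ht
  have h₄ := h.2
  linarith

theorem OppositeParity.ne (h : S.OppositeParity S') : S.val t s ≠ S'.val t s' := by
  obtain ⟨h₁, h₂, h₃, h₄⟩ := h
  intro h
  obtain ⟨a, ha⟩ := Int.dvd_of_emod_eq_zero h₁
  obtain ⟨b, hb⟩ := Int.dvd_of_emod_eq_zero h₂
  obtain ⟨c, hc⟩ := Int.dvd_of_emod_eq_zero h₃
  have : S.c₀ - S'.c₀ = 2 * (b * s' - a * s - c * t) := by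
    unfold val at h
    rw [ha, hb] at h
    linear_combination h - hc * t
  omega

theorem InRange.nonneg (h : S.InRange) (ht : 0 ≤ t) (hs : 0 ≤ s) (hst : S.σ = 0 ∨ s < t) :
    0 ≤ S.val t s := by
  have h₁ := le_val hs hst
  have h₂ := mul_nonneg h.1 ht
  have h₃ := h.2.1
  linarith

theorem InRange.lt (h : S.InRange) (ht : 0 ≤ t) (hs : 0 ≤ s) (hst : S.σ = 0 ∨ s < t) :
    S.val t s < 6 * t + 5 := by
  have h₁ := val_le hs hst
  have h₂ := mul_le_mul_of_nonneg_right h.2.2.1 ht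
  have h₃ := h.2.2.2
  linarith

end Slot

/-- A parametric family of base triples on five groups: the differences are
`a₁ t + a₀ + α s` and `b₁ t + b₀ + β s`, and their sum is to be reduced by `c` times the
modulus. A family with `α = 0` is a single triple; otherwise `s` ranges over `[0, t)`. -/
structure Family where
  i : Fin 5
  j : Fin 5
  k : Fin 5
  a₁ : ℤ
  a₀ : ℤ
  α : ℤ
  b₁ : ℤ
  b₀ : ℤ
  β : ℤ
  c : ℤ

namespace Family

/-- The number of triples in a family. -/
def length (F : Family) (t : ℕ) : ℕ := if F.α = 0 then 1 else t

/-- The three progressions of differences of a family. -/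
def slot (F : Family) : Fin 3 → Slot :=
  ![⟨F.i, F.j, F.a₁, F.a₀, F.α⟩, ⟨F.j, F.k, F.b₁, F.b₀, F.β⟩,
    ⟨F.i, F.k, F.a₁ + F.b₁ - 6 * F.c, F.a₀ + F.b₀ - 5 * F.c, F.α + F.β⟩]

end Family

/-- Families of triples packing the differences modulo `6 t + 5` on five groups. Exactly two
differences remain uncovered, both between the first two groups, and one of them is zero. -/
def packing : Fin 36 → Family :=
  ![⟨0, 1, 2, 5, 5, 1, 4, 3, 1, 1⟩, ⟨0, 1, 2, 2, 3, 1, 4, 1, -2, 0⟩,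
    ⟨0, 1, 3, 3, 4, 2, 6, 3, -1, 1⟩, ⟨0, 1, 3, 3, 3, 2, 1, 0, -1, 0⟩,
    ⟨0, 1, 4, 1, 2, 1, 0, 1, 1, 0⟩, ⟨0, 1, 4, 0, 1, 1, 5, 3, -2, 0⟩,
    ⟨0, 2, 3, 2, 2, 1, 4, 5, 1, 1⟩, ⟨0, 2, 3, 3, 2, 2, 2, 3, -1, 0⟩,
    ⟨0, 2, 4, 0, 1, 1, 6, 3, -2, 0⟩, ⟨0, 2, 4, 1, 1, 1, 6, 4, -2, 1⟩,
    ⟨0, 3, 4, 2, 2, 1, 5, 5, 1, 1⟩, ⟨0, 3, 4, 0, 1, 2, 3, 4, -1, 0⟩,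
    ⟨1, 2, 3, 5, 4, 1, 4, 3, -2, 1⟩, ⟨1, 2, 3, 2, 0, 2, 1, 3, -1, 0⟩,
    ⟨1, 2, 4, 1, 0, 1, 2, 4, 1, 0⟩, ⟨1, 2, 4, 0, 0, 1, 2, 0, -2, 0⟩,
    ⟨1, 3, 4, 1, 1, 1, 5, 3, -2, 0⟩, ⟨1, 3, 4, 4, 4, 1, 5, 4, -2, 1⟩,
    ⟨2, 3, 4, 5, 5, 1, 1, 3, 1, 1⟩, ⟨2, 3, 4, 2, 4, 2, 1, 1, -1, 0⟩,
    ⟨0, 1, 2, 5, 4, 0, 6, 4, 0, 1⟩, ⟨0, 1, 3, 5, 3, 0, 0, 0, 0, 0⟩,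
    ⟨0, 1, 4, 1, 1, 0, 2, 1, 0, 0⟩, ⟨0, 2, 3, 2, 1, 0, 4, 4, 0, 1⟩,
    ⟨0, 2, 3, 5, 2, 0, 0, 2, 0, 0⟩, ⟨0, 2, 4, 0, 0, 0, 3, 4, 0, 0⟩,
    ⟨0, 2, 4, 5, 4, 0, 2, 2, 0, 1⟩, ⟨0, 3, 4, 2, 1, 0, 1, 2, 0, 0⟩,
    ⟨0, 3, 4, 4, 2, 0, 2, 3, 0, 1⟩, ⟨1, 2, 3, 2, 1, 0, 0, 1, 0, 0⟩,
    ⟨1, 2, 3, 4, 0, 0, 0, 3, 0, 0⟩, ⟨1, 2, 4, 4, 2, 0, 2, 3, 0, 1⟩,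
    ⟨1, 2, 4, 5, 3, 0, 0, 1, 0, 0⟩, ⟨1, 3, 4, 6, 4, 0, 2, 4, 0, 1⟩,
    ⟨1, 3, 4, 2, 1, 0, 0, 1, 0, 0⟩, ⟨2, 3, 4, 0, 0, 0, 0, 0, 0, 0⟩]

theorem packing_sorted (f : Fin 36) :
    (packing f).i < (packing f).j ∧ (packing f).j < (packing f).k := by
  revert f
  decide +kernel

theorem packing_inRange (f : Fin 36) (n : Fin 3) : ((packing f).slot n).InRange := by
  revert f n
  decide +kernel

theorem packing_slope (f : Fin 36) (n : Fin 3) :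
    ((packing f).slot n).σ = 0 ↔ (packing f).α = 0 := by
  revert f n
  decide +kernel

theorem packing_pos (f : Fin 36) (n : Fin 3) (hp : ((packing f).slot n).p = 0)
    (hq : ((packing f).slot n).q = 1) :
    1 ≤ ((packing f).slot n).c₀ - min ((packing f).slot n).σ 0 := by
  revert f n
  decide +kernel

theorem packing_disjoint (f g : Fin 36) (n l : Fin 3)
    (hp : ((packing f).slot n).p = ((packing g).slot l).p)
    (hq : ((packing f).slot n).q = ((packing g).slot l).q) :
    (f = g ∧ n = l) ∨ ((packing f).slot n).Before ((packing g).slot l) ∨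
      ((packing g).slot l).Before ((packing f).slot n) ∨
      ((packing f).slot n).OppositeParity ((packing g).slot l) := by
  revert f g n l
  decide +kernel

/-- Index of the triples of `packing`. -/
abbrev PackingIndex (t : ℕ) : Type := Σ f : Fin 36, Fin ((packing f).length t)

theorem card_packingIndex (t : ℕ) : Fintype.card (PackingIndex t) = 20 * t + 16 := by
  have h₁ : (Finset.univ.filter fun f => (packing f).α = 0).card = 16 := by decide +kernel
  have h₂ : (Finset.univ.filter fun f => ¬ (packing f).α = 0).card = 20 := by decide +kernel
  rw [Fintype.card_sigma, Finset.sum_congr rfl fun f _ => Fintype.card_fin _]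
  simp only [Family.length, Finset.sum_ite, Finset.sum_const, h₁, h₂, smul_eq_mul]
  ring

section Packing

variable {t : ℕ}

theorem packingIndex_bound (a : PackingIndex t) (n : Fin 3) :
    ((packing a.1).slot n).σ = 0 ∨ ((a.2 : ℕ) : ℤ) < t := by
  rw [packing_slope]
  have h := a.2.2
  unfold Family.length at h
  split_ifs at h with h'
  · exact Or.inl h'
  · exact Or.inr (by exact_mod_cast h)

/-- The difference of a triple of `packing` in position `n`. -/
def packingVal (a : PackingIndex t) (n : Fin 3) : ℤ :=
  ((packing a.1).slot n).val t ((a.2 : ℕ) : ℤ)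

theorem packingVal_nonneg (a : PackingIndex t) (n : Fin 3) : 0 ≤ packingVal a n :=
  (packing_inRange a.1 n).nonneg (by positivity) (by positivity) (packingIndex_bound a n)

theorem packingVal_lt (a : PackingIndex t) (n : Fin 3) : packingVal a n < 6 * t + 5 :=
  (packing_inRange a.1 n).lt (by positivity) (by positivity) (packingIndex_bound a n)

theorem eq_of_packingVal_eq {a b : PackingIndex t} {n l : Fin 3}
    (hp : ((packing a.1).slot n).p = ((packing b.1).slot l).p)
    (hq : ((packing a.1).slot n).q = ((packing b.1).slot l).q)
    (h : packingVal a n = packingVal b l) : a = b := by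
  have ha := packingIndex_bound a n
  have hb := packingIndex_bound b l
  rcases packing_disjoint a.1 b.1 n l hp hq with ⟨h₁, rfl⟩ | h₁ | h₁ | h₁
  · obtain ⟨f, s⟩ := a
    obtain ⟨g, s'⟩ := b
    obtain rfl : f = g := h₁
    congr 1
    ext
    by_cases hσ : ((packing f).slot n).σ = 0
    · have hα := (packing_slope f n).1 hσ
      have h₂ := s.2
      have h₃ := s'.2
      simp only [Family.length, hα, if_true] at h₂ h₃
      omega
    · simpa [packingVal, Slot.val, hσ] using h
  · exact absurd h (h₁.lt (by positivity) (by positivity) ha (by positivity) hb).ne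
  · exact absurd h (h₁.lt (by positivity) (by positivity) hb (by positivity) ha).ne'
  · exact absurd h h₁.ne

theorem packingVal_pos {a : PackingIndex t} {n : Fin 3} (hp : ((packing a.1).slot n).p = 0)
    (hq : ((packing a.1).slot n).q = 1) : 0 < packingVal a n := by
  have h₁ := Slot.le_val (t := t) (s := ((a.2 : ℕ) : ℤ)) (by positivity) (packingIndex_bound a n)
  have h₂ := packing_pos a.1 n hp hq
  have h₃ := mul_nonneg (packing_inRange a.1 n).1 (Nat.cast_nonneg (α := ℤ) t)
  unfold packingVal
  linarith

end Packing

/-- A triangle of groups with labels modulo 2 on the edges `ij` and `jk`; the label of `ik` is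
their sum. -/
structure Triangle where
  i : Fin 11
  j : Fin 11
  k : Fin 11
  α : ZMod 2
  β : ZMod 2

/-- Labelled triangles decomposing the part of the doubled complete graph on eleven groups that
is covered neither by two complete graphs on five groups nor by a doubled triangle. -/
def triangles : Fin 28 → Triangle :=
  ![⟨0, 1, 10, 1, 0⟩, ⟨0, 2, 7, 1, 0⟩, ⟨0, 3, 9, 1, 1⟩, ⟨0, 4, 5, 1, 0⟩,
    ⟨0, 6, 10, 1, 1⟩, ⟨0, 8, 9, 1, 0⟩, ⟨1, 2, 7, 1, 1⟩, ⟨1, 3, 10, 1, 0⟩,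
    ⟨1, 4, 8, 1, 0⟩, ⟨1, 6, 7, 0, 1⟩, ⟨1, 6, 8, 1, 1⟩, ⟨2, 3, 6, 1, 1⟩,
    ⟨2, 4, 9, 1, 0⟩, ⟨2, 5, 8, 1, 1⟩, ⟨2, 5, 10, 0, 0⟩, ⟨2, 6, 9, 1, 1⟩,
    ⟨2, 8, 10, 1, 0⟩, ⟨3, 4, 6, 1, 1⟩, ⟨3, 5, 7, 1, 1⟩, ⟨3, 5, 10, 0, 1⟩,
    ⟨3, 7, 8, 1, 1⟩, ⟨3, 8, 9, 1, 1⟩, ⟨4, 5, 6, 1, 1⟩, ⟨4, 7, 9, 1, 0⟩,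
    ⟨4, 7, 10, 0, 1⟩, ⟨4, 8, 10, 1, 1⟩, ⟨6, 9, 10, 0, 0⟩, ⟨7, 9, 10, 1, 1⟩]

/-- Two embeddings of five groups into eleven groups, sharing the first group. -/
def embed (b : Bool) (g : Fin 5) : Fin 11 :=
  if b ∧ g ≠ 0 then g.natAdd 4 |>.castLE (by omega) else g.castLE (by omega)

/-- The labelled edges used by each of the pieces of the decomposition. -/
def support : Fin 28 ⊕ Bool ⊕ Unit → List (Fin 11 × Fin 11 × ZMod 2)
  | .inl c => [((triangles c).i, (triangles c).j, (triangles c).α),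
      ((triangles c).j, (triangles c).k, (triangles c).β),
      ((triangles c).i, (triangles c).k, (triangles c).α + (triangles c).β)]
  | .inr (.inl b) => ((List.finRange 5 ×ˢ List.finRange 5).filter fun g => g.1 < g.2).map
      fun g => (embed b g.1, embed b g.2, 0)
  | .inr (.inr _) => [(1, 5, 0), (1, 5, 1), (5, 9, 0), (5, 9, 1), (1, 9, 0), (1, 9, 1)]

theorem support_disjoint (P Q : Fin 28 ⊕ Bool ⊕ Unit) :
    P = Q ∨ ∀ x ∈ support P, x ∉ support Q := by
  have h : ∀ P Q, P = Q ∨ ((support P).all fun x => decide (x ∉ support Q)) = true := by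
    decide +kernel
  simpa only [List.all_eq_true, decide_eq_true_eq] using h P Q

theorem triangles_sorted (c : Fin 28) :
    (triangles c).i < (triangles c).j ∧ (triangles c).j < (triangles c).k := by
  revert c
  decide +kernel

theorem embed_strictMono (b : Bool) : StrictMono (embed b) := by
  revert b
  unfold StrictMono
  decide +kernel

section Assembly

variable (t : ℕ)

/-- Index of the base triples of the design. -/
abbrev DesignIndex : Type :=
  (Fin 28 × Fin (6 * t + 5)) ⊕ (Bool × PackingIndex t) ⊕ Fin (12 * t + 9) ⊕ Unit

/-- The base triples of the design. -/
def design : DesignIndex t → BaseTriple 11 (ZMod 2 × ZMod (6 * t + 5))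
  | .inl (c, x) => ⟨(triangles c).i, (triangles c).j, (triangles c).k,
      ((triangles c).α, ((x : ℕ) : ZMod (6 * t + 5))),
      ((triangles c).β, ((x : ℕ) : ZMod (6 * t + 5)))⟩
  | .inr (.inl (b, a)) => ⟨embed b (packing a.1).i, embed b (packing a.1).j,
      embed b (packing a.1).k, (0, (packingVal a 0 : ZMod (6 * t + 5))),
      (0, (packingVal a 1 : ZMod (6 * t + 5)))⟩
  | .inr (.inr (.inl x)) => ⟨1, 5, 9, ((x + 1 : ℕ) : ZMod 2 × ZMod (6 * t + 5)),
      ((if (x : ℕ) < 6 * t + 5 then x else x + 1 : ℕ) : ZMod 2 × ZMod (6 * t + 5))⟩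
  | .inr (.inr (.inr _)) => ⟨0, 1, 5, 0, 0⟩

/-- The piece of the decomposition to which a base triple belongs. The last base triple, made
from leftovers of several pieces, has none. -/
def piece : DesignIndex t → Option (Fin 28 ⊕ Bool ⊕ Unit)
  | .inl (c, _) => some (.inl c)
  | .inr (.inl (b, _)) => some (.inr (.inl b))
  | .inr (.inr (.inl _)) => some (.inr (.inr ()))
  | .inr (.inr (.inr _)) => none

variable {t}

theorem design_sorted (a : DesignIndex t) : (design t a).Sorted := by
  rcases a with ⟨c, x⟩ | ⟨b, a⟩ | x | _
  · exact triangles_sorted c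
  · exact ⟨embed_strictMono b (packing_sorted a.1).1, embed_strictMono b (packing_sorted a.1).2⟩
  · exact ⟨by simp [design], by simp [design]⟩
  · exact ⟨by simp [design], by simp [design]⟩

theorem covers_packing_iff {b : Bool} {a : PackingIndex t} {p q : Fin 11}
    {x : ZMod 2 × ZMod (6 * t + 5)} :
    (design t (.inr (.inl (b, a)))).Covers p q x ↔
      ∃ n, p = embed b ((packing a.1).slot n).p ∧ q = embed b ((packing a.1).slot n).q ∧
        x = (0, (packingVal a n : ZMod (6 * t + 5))) := by
  have h : (packingVal a 0 : ZMod (6 * t + 5)) + (packingVal a 1 : ZMod (6 * t + 5)) =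
      (packingVal a 2 : ZMod (6 * t + 5)) := by
    have h₁ : packingVal a 0 + packingVal a 1 =
        packingVal a 2 + (packing a.1).c * ((6 * t + 5 : ℕ) : ℤ) := by
      simp [packingVal, Slot.val, Family.slot]
      ring
    have h₂ := congrArg (Int.cast (R := ZMod (6 * t + 5))) h₁
    rw [Int.cast_add, Int.cast_add, Int.cast_mul, Int.cast_natCast, ZMod.natCast_self, mul_zero,
      add_zero] at h₂
    exact h₂
  have h' : ((0 : ZMod 2), (packingVal a 0 : ZMod (6 * t + 5))) +
      (0, (packingVal a 1 : ZMod (6 * t + 5))) = (0, (packingVal a 2 : ZMod (6 * t + 5))) := by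
    rw [Prod.mk_add_mk, h, add_zero]
  simp only [BaseTriple.Covers, design, h', Family.slot]
  constructor
  · rintro (h | h | h)
    exacts [⟨0, h⟩, ⟨1, h⟩, ⟨2, h⟩]
  · rintro ⟨n, h⟩
    fin_cases n
    exacts [Or.inl h, Or.inr (Or.inl h), Or.inr (Or.inr h)]

/-- The differences of the third kind of base triples, as natural numbers. -/
def doubledVal (t x : ℕ) : Fin 3 → ℕ :=
  ![x + 1, if x < 6 * t + 5 then x else x + 1,
    if x < 6 * t + 5 then 2 * x + 1 else 2 * x + 2 - 2 * (6 * t + 5)]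

theorem cast_modulus : ((2 * (6 * t + 5) : ℕ) : ZMod 2 × ZMod (6 * t + 5)) = 0 := by
  ext
  · rw [Prod.fst_natCast, Nat.cast_mul, ZMod.natCast_self, zero_mul, Prod.fst_zero]
  · rw [Prod.snd_natCast, Nat.cast_mul, ZMod.natCast_self, mul_zero, Prod.snd_zero]

theorem packing_slot_lt (f : Fin 36) (n : Fin 3) :
    ((packing f).slot n).p < ((packing f).slot n).q := by
  revert f n
  decide +kernel

theorem mem_support_embed (b : Bool) {g h : Fin 5} (hgh : g < h) :
    (embed b g, embed b h, 0) ∈ support (.inr (.inl b)) := by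
  revert b g h
  decide +kernel

theorem mem_support_doubled (l : ZMod 2) : (1, 5, l) ∈ support (.inr (.inr ())) ∧
    (5, 9, l) ∈ support (.inr (.inr ())) ∧ (1, 9, l) ∈ support (.inr (.inr ())) := by
  revert l
  decide +kernel

theorem Covers.mem_support {a : DesignIndex t} {P} (hP : piece t a = some P) {p q : Fin 11}
    {x : ZMod 2 × ZMod (6 * t + 5)} (h : (design t a).Covers p q x) :
    (p, q, x.1) ∈ support P := by
  rcases a with ⟨c, y⟩ | ⟨b, a⟩ | y | _
  · obtain rfl := Option.some.inj hP
    rcases h with ⟨rfl, rfl, rfl⟩ | ⟨rfl, rfl, rfl⟩ | ⟨rfl, rfl, rfl⟩ <;> simp [support, design]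
  · obtain rfl := Option.some.inj hP
    obtain ⟨n, rfl, rfl, rfl⟩ := covers_packing_iff.1 h
    exact mem_support_embed b (packing_slot_lt _ _)
  · obtain rfl := Option.some.inj hP
    have := mem_support_doubled x.1
    rcases h with ⟨rfl, rfl, -⟩ | ⟨rfl, rfl, -⟩ | ⟨rfl, rfl, -⟩
    exacts [this.1, this.2.1, this.2.2]
  · cases hP

theorem eq_of_cast_eq {m : ℕ} {a b : ℤ} (ha : 0 ≤ a) (ham : a < m) (hb : 0 ≤ b) (hbm : b < m)
    (h : (a : ZMod m) = b) : a = b := by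
  rw [ZMod.intCast_eq_intCast_iff'] at h
  rwa [Int.emod_eq_of_lt ha ham, Int.emod_eq_of_lt hb hbm] at h

theorem eq_of_natCast_prod_eq {m : ℕ} (hm : m.Coprime 2) {a b : ℕ} (ha : a < 2 * m)
    (hb : b < 2 * m) (h : (a : ZMod 2 × ZMod m) = b) : a = b := by
  have h₁ := congrArg Prod.fst h
  have h₂ := congrArg Prod.snd h
  rw [Prod.fst_natCast, Prod.fst_natCast, ZMod.natCast_eq_natCast_iff] at h₁
  rw [Prod.snd_natCast, Prod.snd_natCast, ZMod.natCast_eq_natCast_iff] at h₂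
  have h₃ := (Nat.modEq_and_modEq_iff_modEq_mul hm.symm).1 ⟨h₁, h₂⟩
  exact h₃.eq_of_lt_of_lt ha hb

theorem coprime_modulus (t : ℕ) : (6 * t + 5).Coprime 2 := by
  rw [Nat.coprime_two_right, Nat.odd_iff]
  omega

theorem triangle_inj {c : Fin 28} {y z : Fin (6 * t + 5)} {p q : Fin 11}
    {x : ZMod 2 × ZMod (6 * t + 5)} (h : (design t (.inl (c, y))).Covers p q x)
    (h' : (design t (.inl (c, z))).Covers p q x) : y = z := by
  obtain ⟨h₁, h₂⟩ := triangles_sorted c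
  have key : ((y : ℕ) : ZMod (6 * t + 5)) = ((z : ℕ) : ZMod (6 * t + 5)) → y = z := by
    rw [ZMod.natCast_eq_natCast_iff]
    exact fun h => Fin.ext (h.eq_of_lt_of_lt y.2 z.2)
  have key' : ((y : ℕ) : ZMod (6 * t + 5)) + (y : ℕ) = ((z : ℕ) : ZMod (6 * t + 5)) + (z : ℕ) →
      y = z := by
    rw [← two_mul, ← two_mul]
    intro h
    apply key
    refine IsUnit.mul_left_cancel ?_ h
    exact_mod_cast (ZMod.isUnit_iff_coprime 2 (6 * t + 5)).2 (coprime_modulus t).symm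
  simp only [BaseTriple.Covers, design] at h h'
  rcases h with ⟨rfl, rfl, rfl⟩ | ⟨rfl, rfl, rfl⟩ | ⟨rfl, rfl, rfl⟩ <;>
    rcases h' with ⟨h₃, h₄, h₅⟩ | ⟨h₃, h₄, h₅⟩ | ⟨h₃, h₄, h₅⟩ <;>
    first
    | exact key (congrArg Prod.snd h₅)
    | exact key' (congrArg Prod.snd h₅)
    | (exfalso; omega)

theorem covers_doubled {y : Fin (12 * t + 9)} {p q : Fin 11}
    {x : ZMod 2 × ZMod (6 * t + 5)} (h : (design t (.inr (.inr (.inl y)))).Covers p q x) :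
    (p = 1 ∧ q = 5 ∧ x = (doubledVal t y 0 : ℕ)) ∨ (p = 5 ∧ q = 9 ∧ x = (doubledVal t y 1 : ℕ)) ∨
      (p = 1 ∧ q = 9 ∧ x = (doubledVal t y 2 : ℕ)) := by
  rcases h with h | h | ⟨h₁, h₂, h₃⟩
  · exact Or.inl h
  · exact Or.inr (Or.inl h)
  · refine Or.inr (Or.inr ⟨h₁, h₂, ?_⟩)
    rw [h₃]
    simp only [design, doubledVal, Matrix.cons_val]
    rw [← Nat.cast_add]
    split_ifs with h
    · congr 1
      omega
    · have : (y : ℕ) + 1 + (y + 1) = (2 * y + 2 - 2 * (6 * t + 5)) + 2 * (6 * t + 5) := by omega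
      rw [this, Nat.cast_add, cast_modulus, add_zero]

theorem doubledVal_lt (y : Fin (12 * t + 9)) (n : Fin 3) :
    doubledVal t y n < 2 * (6 * t + 5) := by
  have := y.2
  fin_cases n <;> simp [doubledVal] <;> (try split_ifs) <;> omega

theorem doubledVal_inj {y z : Fin (12 * t + 9)} {n : Fin 3}
    (h : (doubledVal t y n : ZMod 2 × ZMod (6 * t + 5)) = (doubledVal t z n : ℕ)) : y = z := by
  have h := eq_of_natCast_prod_eq (coprime_modulus t) (doubledVal_lt y n) (doubledVal_lt z n) h
  have hy := y.2
  have hz := z.2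
  ext
  fin_cases n <;> simp [doubledVal] at h <;> (try split_ifs at h) <;> omega

theorem doubled_inj {y z : Fin (12 * t + 9)} {p q : Fin 11} {x : ZMod 2 × ZMod (6 * t + 5)}
    (h : (design t (.inr (.inr (.inl y)))).Covers p q x)
    (h' : (design t (.inr (.inr (.inl z)))).Covers p q x) : y = z := by
  rcases covers_doubled h with ⟨rfl, rfl, rfl⟩ | ⟨rfl, rfl, rfl⟩ | ⟨rfl, rfl, rfl⟩ <;>
    rcases covers_doubled h' with ⟨h₃, h₄, h₅⟩ | ⟨h₃, h₄, h₅⟩ | ⟨h₃, h₄, h₅⟩ <;>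
    first
    | exact doubledVal_inj h₅
    | (exfalso; revert h₃; decide)
    | (exfalso; revert h₄; decide)

theorem packing_inj {b : Bool} {a a' : PackingIndex t} {p q : Fin 11}
    {x : ZMod 2 × ZMod (6 * t + 5)} (h : (design t (.inr (.inl (b, a)))).Covers p q x)
    (h' : (design t (.inr (.inl (b, a')))).Covers p q x) : a = a' := by
  obtain ⟨n, rfl, rfl, rfl⟩ := covers_packing_iff.1 h
  obtain ⟨l, hp, hq, hx⟩ := covers_packing_iff.1 h'
  refine eq_of_packingVal_eq ((embed_strictMono b).injective hp)
    ((embed_strictMono b).injective hq) (eq_of_cast_eq (m := 6 * t + 5) (packingVal_nonneg a n) ?_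
      (packingVal_nonneg a' l) ?_ (congrArg Prod.snd hx))
  · exact_mod_cast packingVal_lt a n
  · exact_mod_cast packingVal_lt a' l

theorem embed_preimage : ∀ (b : Bool) (g h : Fin 5) (p q : Fin 11), p = embed b g → q = embed b h →
    (p = 0 ∧ q = 1) ∨ (p = 0 ∧ q = 5) ∨ (p = 1 ∧ q = 5) → g = 0 ∧ h = 1 := by
  decide +kernel

theorem closing_notMem_support (c : Fin 28) : (0, 1, 0) ∉ support (.inl c) ∧
    (0, 5, 0) ∉ support (.inl c) ∧ (1, 5, 0) ∉ support (.inl c) := by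
  revert c
  decide +kernel

theorem closing_not_covers {a : DesignIndex t} {P} (hP : piece t a = some P) {p q : Fin 11}
    {x : ZMod 2 × ZMod (6 * t + 5)} (h : (design t a).Covers p q x)
    (h₀ : (design t (.inr (.inr (.inr ())))).Covers p q x) : False := by
  have h' : x = 0 ∧ ((p = 0 ∧ q = 1) ∨ (p = 0 ∧ q = 5) ∨ (p = 1 ∧ q = 5)) := by
    simp only [BaseTriple.Covers, design, add_zero] at h₀
    tauto
  clear h₀
  obtain ⟨rfl, h'⟩ := h'
  rcases a with ⟨c, y⟩ | ⟨b, a⟩ | y | _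
  · have := Covers.mem_support (P := .inl c) rfl h
    obtain ⟨h₁, h₂, h₃⟩ := closing_notMem_support c
    rcases h' with ⟨rfl, rfl⟩ | ⟨rfl, rfl⟩ | ⟨rfl, rfl⟩
    exacts [h₁ this, h₂ this, h₃ this]
  · obtain ⟨n, hp, hq, hx⟩ := covers_packing_iff.1 h
    obtain ⟨h₁, h₂⟩ := embed_preimage _ _ _ _ _ hp hq h'
    have hpos := packingVal_pos h₁ h₂
    refine hpos.ne (eq_of_cast_eq (m := 6 * t + 5) le_rfl (by positivity) hpos.le ?_ ?_)
    · exact_mod_cast packingVal_lt a n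
    · rw [Int.cast_zero]
      exact congrArg Prod.snd hx
  · rcases covers_doubled h with ⟨rfl, rfl, hx⟩ | ⟨rfl, rfl, hx⟩ | ⟨rfl, rfl, hx⟩
    · rw [← Nat.cast_zero] at hx
      have := eq_of_natCast_prod_eq (coprime_modulus t) (by omega) (doubledVal_lt y 0) hx
      simp [doubledVal] at this
    · revert h'
      decide
    · revert h'
      decide
  · cases hP

theorem design_inj (a b : DesignIndex t) (p q : Fin 11) (x : ZMod 2 × ZMod (6 * t + 5))
    (ha : (design t a).Covers p q x) (hb : (design t b).Covers p q x) : a = b := by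
  rcases hP : piece t a with _ | P <;> rcases hQ : piece t b with _ | Q
  · rcases a with _ | _ | _ | _ <;> cases hP
    rcases b with _ | _ | _ | _ <;> cases hQ
    rfl
  · rcases a with _ | _ | _ | _ <;> cases hP
    exact (closing_not_covers hQ hb ha).elim
  · rcases b with _ | _ | _ | _ <;> cases hQ
    exact (closing_not_covers hP ha hb).elim
  · obtain rfl := (support_disjoint P Q).resolve_right fun h =>
      h _ (Covers.mem_support hP ha) (Covers.mem_support hQ hb)
    rcases a with ⟨c, y⟩ | ⟨r, a⟩ | y | _ <;> rcases b with ⟨c', z⟩ | ⟨r', b⟩ | z | _ <;>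
      simp only [piece, Option.some.injEq, reduceCtorEq] at hP hQ <;>
      subst hP <;> (try cases hQ)
    · rw [triangle_inj ha hb]
    · rw [packing_inj ha hb]
    · rw [doubled_inj ha hb]

theorem card_designIndex (t : ℕ) : Fintype.card (DesignIndex t) = 220 * t + 182 := by
  simp only [Fintype.card_sum, Fintype.card_prod, Fintype.card_fin, Fintype.card_bool,
    Fintype.card_unit, card_packingIndex]
  ring

end Assembly

/-- For every positive integer w with w ≡ 10 (mod 12), there
exists a 3-SCGDP of type w^{11} (a w-cyclic 3-GDP of type w^{11}, i.e. the
case v = 1) with J*(11×1×w,3,1) base blocks. -/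
theorem exists_scgdp_type_w_pow_eleven
    (w : ℕ) (hw : 0 < w) (hmod : w % 12 = 10) :
    ∃ ℬ : Finset (Finset (Fin 11 × Fin 1 × ZMod w)),
      IsCyclicGDP 11 1 w 3 (Jstar 11 1 w) ℬ := by
  obtain ⟨t, rfl⟩ : ∃ t, w = 2 * (6 * t + 5) := ⟨w / 12, by omega⟩
  have hJ : Jstar 11 1 (2 * (6 * t + 5)) = Fintype.card (DesignIndex t) := by
    rw [card_designIndex]
    unfold Jstar J
    rw [if_pos (by omega)]
    omega
  have : NeZero (2 * (6 * t + 5)) := ⟨hw.ne'⟩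
  let f := (ZMod.chineseRemainder (coprime_modulus t).symm).symm.toAddEquiv
  rw [hJ]
  refine exists_isCyclicGDP_of_baseTriples (fun a => (design t a).map f)
    (fun a => design_sorted a) fun a b p q x ha hb => ?_
  rw [BaseTriple.covers_map_iff] at ha hb
  exact design_inj a b p q _ ha hb
end
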